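/- (Theorem 2 of the paper.) Let p be a prime, let a, b be integers with a ≢ 0 (mod p), and define the explicit inversive congruential sequence x_n ≡ (an + b)^{p−2} (mod p) with x_n ∈ {0,…,p−1}, and the normalized sequence u_n = x_n/p ∈ [0,1). Fix a dimension k with 2 ≤ k < p and integers 0 = n_1 < n_2 < … < n_k < p, and form the points u⃗_n = (u_{n+n_1}, …, u_{n+n_k}) ∈ [0,1)^k for 0 ≤ n < p. Then the discrepancy D_p^{(k)} = D_p(u⃗_0, …, u⃗_{p−1}) satisfies D_p^{(k)} < 2p^{−1/2}·((k−1)·((2/π)·log p + 7/5)^k + 1) + k·p^{−1}. -/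

import Mathlib

/-- The (star) discrepancy of the points `ξ 0, …, ξ (N-1) ∈ [0,1)^k`:
`D_N(ξ) = sup_J |F_N(J) − V(J)|`, the supremum over all subintervals
`J = ∏_i [α i, β i) ⊆ [0,1)^k`, where `F_N(J)` is `N⁻¹` times the number of points
falling into `J` and `V(J)` is the volume of `J`. -/
noncomputable def discrepancy {k N : ℕ} (ξ : Fin N → Fin k → ℝ) : ℝ :=
  sSup {d : ℝ | ∃ α β : Fin k → ℝ,
    (∀ i, 0 ≤ α i ∧ α i ≤ β i ∧ β i ≤ 1) ∧
    d = |((Finset.univ.filter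
            (fun n : Fin N => ∀ i, α i ≤ ξ n i ∧ ξ n i < β i)).card : ℝ) / N -
          ∏ i, (β i - α i)|}

open Polynomial in
/-- If a polynomial `∑ c_d T^d` of degree at most `D` with `c_0 = 1` has logarithmic derivative
`∑ S_j T^(j-1)` with `S_j = O(r^j)`, then all its roots have modulus at least `1 / r`. -/
theorem norm_root_ge_of_newton {c S : ℕ → ℂ} {L : ℂ[X]} {C r : ℝ} (hr : 0 < r)
    (hL : ∀ d, L.coeff d = c d) (hc0 : c 0 = 1) (hS : ∀ j, ‖S j‖ ≤ C * r ^ j)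
    (hrec : ∀ d : ℕ, (d : ℂ) * c d = ∑ ij ∈ Finset.HasAntidiagonal.antidiagonal d, S ij.1 * c ij.2)
    {z : ℂ} (hz : L.IsRoot z) : 1 ≤ r * ‖z‖ := by
  by_contra! hlt
  have hC : 0 ≤ C := by have := (norm_nonneg _).trans (hS 0); simpa using this
  have hL0 : L ≠ 0 := by
    rintro rfl
    have := hL 0
    simp [hc0] at this
  have hz0 : z ≠ 0 := by
    rintro rfl
    have : L.coeff 0 = 0 := by rw [coeff_zero_eq_eval_zero]; exact hz
    rw [hL, hc0] at this
    exact one_ne_zero this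
  have key : ∀ t : ℂ, r * ‖t‖ < 1 →
      ∃ s : ℂ, ‖s‖ ≤ C * (1 - r * ‖t‖)⁻¹ ∧ t * L.derivative.eval t = s * L.eval t := by
    intro t ht
    have hgeo : HasSum (fun j => C * (r * ‖t‖) ^ j) (C * (1 - r * ‖t‖)⁻¹) :=
      (hasSum_geometric_of_lt_one (by positivity) ht).mul_left C
    have hb : ∀ j, ‖S j * t ^ j‖ ≤ C * (r * ‖t‖) ^ j := by
      intro j
      rw [norm_mul, norm_pow, mul_pow, ← mul_assoc]
      exact mul_le_mul_of_nonneg_right (hS j) (by positivity)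
    have hs1 : Summable (fun j => ‖S j * t ^ j‖) :=
      Summable.of_nonneg_of_le (fun _ => norm_nonneg _) hb hgeo.summable
    have hcz : ∀ d ∉ Finset.range (L.natDegree + 1), c d = 0 := by
      intro d hd
      rw [← hL]
      exact coeff_eq_zero_of_natDegree_lt (by simpa [Nat.lt_succ_iff] using hd)
    have hs2 : Summable (fun d => ‖c d * t ^ d‖) :=
      summable_of_ne_finset_zero (s := Finset.range (L.natDegree + 1)) (by
        intro d hd; simp [hcz d hd])
    refine ⟨∑' j, S j * t ^ j, tsum_of_norm_bounded hgeo hb, ?_⟩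
    have e1 : L.eval t = ∑' d, c d * t ^ d := by
      rw [eval_eq_sum_range, tsum_eq_sum (s := Finset.range (L.natDegree + 1))]
      · simp [hL]
      · intro d hd; simp [hcz d hd]
    have e2 : t * L.derivative.eval t = ∑' d : ℕ, (d : ℂ) * c d * t ^ d := by
      rw [derivative_eval, sum_over_range _ (by simp),
        tsum_eq_sum (s := Finset.range (L.natDegree + 1)), Finset.mul_sum]
      · refine Finset.sum_congr rfl fun d _ => ?_
        rw [hL]
        rcases d with _ | d
        · simp
        · rw [Nat.add_sub_cancel, pow_succ]; ring
      · intro d hd; simp [hcz d hd]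
    rw [e1, e2, tsum_mul_tsum_eq_tsum_sum_antidiagonal_of_summable_norm hs1 hs2]
    refine tsum_congr fun d => ?_
    rw [hrec, Finset.sum_mul]
    refine Finset.sum_congr rfl fun ij hij => ?_
    rw [← Finset.HasAntidiagonal.mem_antidiagonal.1 hij, pow_add]; ring
  obtain ⟨M, hM, hMz⟩ := exists_eq_pow_rootMultiplicity_mul_and_not_dvd L hL0 z
  have hn : 0 < L.rootMultiplicity z := (rootMultiplicity_pos hL0).2 hz
  obtain ⟨n, hn'⟩ : ∃ n, L.rootMultiplicity z = n + 1 := ⟨_, (Nat.succ_pred hn.ne').symm⟩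
  rw [hn'] at hM
  have hMz' : M.eval z ≠ 0 := fun h => hMz (dvd_iff_isRoot.2 h)
  have hd : ∀ t, L.derivative.eval t =
      (t - z) ^ n * (((n : ℂ) + 1) * M.eval t + (t - z) * M.derivative.eval t) := by
    intro t
    conv_lhs => rw [hM]
    simp [derivative_mul, derivative_pow]
    ring
  set ρ := ‖z‖
  have hcont : Filter.Tendsto (fun t : ℂ => ‖t * (((n : ℂ) + 1) * M.eval t +
      (t - z) * M.derivative.eval t)‖) (nhdsWithin z {z}ᶜ)
      (nhds ‖z * (((n : ℂ) + 1) * M.eval z + (z - z) * M.derivative.eval z)‖) := by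
    refine Filter.Tendsto.mono_left (Continuous.tendsto ?_ z) nhdsWithin_le_nhds
    fun_prop
  have hcont2 : Filter.Tendsto (fun t : ℂ => C * (1 - r * ‖t‖)⁻¹ * ‖(t - z) * M.eval t‖)
      (nhdsWithin z {z}ᶜ) (nhds (C * (1 - r * ‖z‖)⁻¹ * ‖(z - z) * M.eval z‖)) := by
    refine Filter.Tendsto.mono_left ?_ nhdsWithin_le_nhds
    refine Filter.Tendsto.mul (Filter.Tendsto.mul tendsto_const_nhds
      (Filter.Tendsto.inv₀ ?_ (by linarith))) ?_
    · exact Continuous.tendsto (by fun_prop) z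
    · exact Continuous.tendsto (by fun_prop) z
  have hle := le_of_tendsto_of_tendsto hcont hcont2 (by
    have hev : ∀ᶠ t in nhdsWithin z {z}ᶜ, r * ‖t‖ < 1 := by
      refine Filter.Eventually.filter_mono nhdsWithin_le_nhds ?_
      exact (Continuous.tendsto (by fun_prop : Continuous fun t : ℂ => r * ‖t‖) z).eventually
        (gt_mem_nhds hlt)
    filter_upwards [hev, self_mem_nhdsWithin] with t ht htz
    have htz : t - z ≠ 0 := sub_ne_zero.2 htz
    obtain ⟨s, hs, he⟩ := key t ht
    rw [hd t] at he
    have he' : L.eval t = (t - z) ^ n * ((t - z) * M.eval t) := by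
      conv_lhs => rw [hM]
      simp; ring
    rw [he'] at he
    have : t * (((n : ℂ) + 1) * M.eval t + (t - z) * M.derivative.eval t) =
        s * ((t - z) * M.eval t) := by
      apply mul_left_cancel₀ (pow_ne_zero n htz)
      linear_combination he
    rw [this, norm_mul]
    exact mul_le_mul_of_nonneg_right hs (norm_nonneg _))
  have hn1 : (n : ℂ) + 1 ≠ 0 := by exact_mod_cast n.succ_ne_zero
  simp only [sub_self, zero_mul, add_zero, norm_zero, mul_zero] at hle
  have : ‖z * (((n : ℂ) + 1) * M.eval z)‖ = 0 := le_antisymm hle (norm_nonneg _)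
  rw [norm_eq_zero] at this
  exact mul_ne_zero hz0 (mul_ne_zero hn1 hMz') this

open Polynomial in
/-- Newton's identities and a growth bound for the power sums control the first coefficient. -/
theorem norm_coeff_one_le_of_newton {c S : ℕ → ℂ} {D : ℕ} {C r : ℝ} (hr : 0 < r)
    (hc0 : c 0 = 1) (hc : ∀ d, D < d → c d = 0) (hS : ∀ j, ‖S j‖ ≤ C * r ^ j)
    (hrec : ∀ d : ℕ, (d : ℂ) * c d = ∑ ij ∈ Finset.HasAntidiagonal.antidiagonal d, S ij.1 * c ij.2) :
    ‖c 1‖ ≤ D * r := by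
  set L : ℂ[X] := ∑ d ∈ Finset.range (D + 1), monomial d (c d) with hLdef
  have hL : ∀ d, L.coeff d = c d := by
    intro d
    simp only [hLdef, finsetSum_coeff, coeff_monomial, Finset.sum_ite_eq', Finset.mem_range]
    split_ifs with h
    · rfl
    · exact (hc d (by omega)).symm
  have hdeg : L.natDegree ≤ D := natDegree_le_iff_coeff_eq_zero.2 fun d hd => by
    rw [hL]; exact hc d hd
  have h0 : L.eval 0 = 1 := by rw [← coeff_zero_eq_eval_zero, hL, hc0]
  have h1 : L.derivative.eval 0 = c 1 := by
    rw [← coeff_zero_eq_eval_zero, coeff_derivative, hL]; simp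
  have h2 := (IsAlgClosed.splits L).eval_derivative_div_eval_of_ne_zero (x := 0)
    (by rw [h0]; exact one_ne_zero)
  rw [h0, h1, div_one] at h2
  rw [h2]
  refine (norm_multiset_sum_le _).trans ?_
  rw [Multiset.map_map]
  have hcard : (Multiset.card L.roots : ℝ) ≤ D := by
    exact_mod_cast (card_roots' L).trans hdeg
  have hle : (L.roots.map ((fun a => ‖a‖) ∘ fun z => 1 / (0 - z))).sum ≤
      Multiset.card (L.roots.map ((fun a => ‖a‖) ∘ fun z => 1 / (0 - z))) • r := by
    refine Multiset.sum_le_card_nsmul _ _ ?_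
    intro x hx
    obtain ⟨z, hz, rfl⟩ := Multiset.mem_map.1 hx
    have hz1 := norm_root_ge_of_newton hr hL hc0 hS hrec (isRoot_of_mem_roots hz)
    have hzpos : 0 < ‖z‖ := by
      by_contra h
      have : ‖z‖ = 0 := le_antisymm (not_lt.1 h) (norm_nonneg _)
      rw [this] at hz1
      norm_num at hz1
    simp only [Function.comp, zero_sub, norm_div, norm_one, norm_neg]
    rw [div_le_iff₀ hzpos]
    exact hz1
  rw [Multiset.card_map, nsmul_eq_mul] at hle
  exact hle.trans (mul_le_mul_of_nonneg_right hcard hr.le)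

section Stepanov

open Polynomial

theorem exists_nontrivial_relation_of_card_lt {K I J : Type*} [Field K] [Fintype I] [Fintype J]
    (v : J → I → K) (h : Fintype.card J < Fintype.card I) :
    ∃ l : I → K, l ≠ 0 ∧ ∀ j, ∑ i, l i * v j i = 0 := by
  have hker := LinearMap.ker_ne_bot_of_finrank_lt (f := Matrix.mulVecLin (Matrix.of v))
    (by simpa using h)
  obtain ⟨l, hl, hl0⟩ := (Submodule.ne_bot_iff _).1 hker
  refine ⟨l, hl0, fun j => ?_⟩
  have := congrFun (LinearMap.mem_ker.1 hl) j
  simpa [Matrix.mulVec, dotProduct, mul_comm] using this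

variable {p : ℕ} {F : Type*} [Field F]

/-- Multiplication by `z + κ R` on the vectors `(u_0, …, u_{p-1})` representing `∑ u_j z^j`, where
`z ^ p = R ^ (p - 1) z + R ^ (p - 1) P`. -/
noncomputable def curveMul (p : ℕ) (R P : F[X]) (κ : F) (u : ℕ → F[X]) (j : ℕ) : F[X] :=
  (if j = 0 then u (p - 1) * (R ^ (p - 1) * P)
    else if j = 1 then u 0 + u (p - 1) * R ^ (p - 1) else u (j - 1)) + u j * (C κ * R)

/-- The representation of `∑ u_j z^j` has pole order at most `w` at infinity, where `x` and `z` have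
pole orders `p` and `e`. -/
def HasWeightLE (p e : ℕ) (u : ℕ → F[X]) (w : ℕ) : Prop :=
  ∀ j < p, ∀ i, (u j).coeff i ≠ 0 → p * i + e * j ≤ w

/-- The representation of `∑ u_j z^j` has pole order exactly `w` at infinity. -/
def HasWeight (p e : ℕ) (u : ℕ → F[X]) (w : ℕ) : Prop :=
  HasWeightLE p e u w ∧ ∃ j < p, ∃ i, (u j).coeff i ≠ 0 ∧ p * i + e * j = w

theorem exists_of_coeff_mul_ne_zero {f g : F[X]} {i : ℕ} (h : (f * g).coeff i ≠ 0) :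
    ∃ a b, a + b = i ∧ f.coeff a ≠ 0 ∧ b ≤ g.natDegree := by
  rw [coeff_mul] at h
  obtain ⟨⟨a, b⟩, hab, hne⟩ := Finset.exists_ne_zero_of_sum_ne_zero h
  exact ⟨a, b, Finset.HasAntidiagonal.mem_antidiagonal.1 hab, left_ne_zero_of_mul hne,
    le_natDegree_of_ne_zero (right_ne_zero_of_mul hne)⟩

theorem HasWeightLE.curveMul {e M : ℕ} (hp : 2 ≤ p) (he : e = 1 + p * M) {R P : F[X]}
    (hR : R.natDegree = M) (hP : P.natDegree = M + 1) (κ : F) {u : ℕ → F[X]} {w : ℕ}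
    (hu : HasWeightLE p e u w) : HasWeightLE p e (curveMul p R P κ u) (w + e) := by
  intro j hj i hi
  obtain ⟨m, rfl⟩ : ∃ m, p = m + 2 := ⟨p - 2, by omega⟩
  have hm : m + 2 - 1 = m + 1 := rfl
  rw [_root_.curveMul, coeff_add] at hi
  have hRp : (R ^ (m + 1)).natDegree ≤ (m + 1) * M := by
    rw [← hR]; exact natDegree_pow_le
  have hRpP : (R ^ (m + 1) * P).natDegree ≤ (m + 1) * M + (M + 1) := by
    refine natDegree_mul_le.trans ?_
    omega
  have hκR : (C κ * R).natDegree ≤ M := by rw [← hR]; exact natDegree_C_mul_le _ _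
  by_cases h2 : (u j * (C κ * R)).coeff i = 0
  · rw [h2, add_zero] at hi
    rw [hm] at hi
    split_ifs at hi with h0 h1
    · obtain ⟨a, b, rfl, ha, hb⟩ := exists_of_coeff_mul_ne_zero hi
      have := hu (m + 1) (by omega) a ha
      subst h0 he
      have hb' := hb.trans hRpP
      nlinarith [Nat.mul_le_mul_left (m + 2) hb']
    · rw [coeff_add] at hi
      subst h1
      by_cases h3 : (u 0).coeff i = 0
      · rw [h3, zero_add] at hi
        obtain ⟨a, b, rfl, ha, hb⟩ := exists_of_coeff_mul_ne_zero hi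
        have := hu (m + 1) (by omega) a ha
        subst he
        have hb' := hb.trans hRp
        nlinarith [Nat.mul_le_mul_left (m + 2) hb']
      · have := hu 0 (by omega) i h3
        omega
    · have := hu (j - 1) (by omega) i hi
      obtain ⟨j, rfl⟩ : ∃ k, j = k + 1 := ⟨j - 1, by omega⟩
      simp only [Nat.add_sub_cancel] at this
      rw [mul_add]; omega
  · obtain ⟨a, b, rfl, ha, hb⟩ := exists_of_coeff_mul_ne_zero h2
    have := hu j hj a ha
    have hb' := Nat.mul_le_mul_left (m + 2) (hb.trans hκR)
    rw [mul_add]; omega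

theorem HasWeight.curveMul_zero {e M : ℕ} (hp : 2 ≤ p) (he : e = 1 + p * M) {R P : F[X]}
    (hRm : R.Monic) (hPm : P.Monic)
    (hR : R.natDegree = M) (hP : P.natDegree = M + 1) {u : ℕ → F[X]} {w : ℕ}
    (hu : HasWeight p e u w) : HasWeight p e (curveMul p R P 0 u) (w + e) := by
  refine ⟨hu.1.curveMul hp he hR hP 0, ?_⟩
  obtain ⟨hle, j, hj, i, hi, hw⟩ := hu
  obtain ⟨m, rfl⟩ : ∃ m, p = m + 2 := ⟨p - 2, by omega⟩
  have hm : m + 2 - 1 = m + 1 := rfl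
  have hRp : (R ^ (m + 1)).natDegree = (m + 1) * M := by
    rw [hRm.natDegree_pow, hR]
  have hRpP : (R ^ (m + 1) * P).natDegree = (m + 1) * M + (M + 1) := by
    rw [(hRm.pow _).natDegree_mul hPm, hRp, hP]
  rcases Nat.lt_or_ge j (m + 1) with hjm | hjm
  · refine ⟨j + 1, by omega, i, ?_, by rw [mul_add]; omega⟩
    rw [curveMul]
    rcases Nat.eq_zero_or_pos j with rfl | hj0
    · simp only [hm, zero_add, one_ne_zero, if_false, if_true, C_0, zero_mul, mul_zero, add_zero,
        coeff_add]
      have : (u (m + 1) * R ^ (m + 1)).coeff i = 0 := by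
        by_contra hne
        obtain ⟨a, b, rfl, ha, hb⟩ := exists_of_coeff_mul_ne_zero hne
        have := hle (m + 1) (by omega) a ha
        rw [hRp] at hb
        subst he
        nlinarith [Nat.mul_le_mul_left (m + 2) hb]
      rw [this, add_zero]
      exact hi
    · simpa [hj0.ne'] using hi
  · obtain rfl : j = m + 1 := by omega
    refine ⟨0, by omega, i + ((m + 1) * M + (M + 1)), ?_, ?_⟩
    · rw [curveMul]
      simp only [hm, if_true, C_0, zero_mul, mul_zero, add_zero]
      rw [coeff_mul_add_eq_of_natDegree_le _ hRpP.le]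
      · rw [← hRpP, ((hRm.pow _).mul hPm).coeff_natDegree, mul_one]
        exact hi
      · refine natDegree_le_iff_coeff_eq_zero.2 fun k hk => ?_
        by_contra hne
        have := hle (m + 1) (by omega) k hne
        nlinarith
    · subst he hw
      ring

theorem HasWeightLE.X_pow_mul {e : ℕ} {u : ℕ → F[X]} {w : ℕ}
    (hu : HasWeightLE p e u w) (a : ℕ) :
    HasWeightLE p e (fun j => X ^ a * u j) (w + p * a) := by
  intro j hj i hi
  rw [coeff_X_pow_mul'] at hi
  split_ifs at hi with h
  · have := hu j hj _ hi
    obtain ⟨b, rfl⟩ := Nat.exists_eq_add_of_le h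
    rw [Nat.add_sub_cancel_left] at this
    rw [mul_add]; omega
  · exact absurd rfl hi

theorem HasWeight.X_pow_mul {e : ℕ} {u : ℕ → F[X]} {w : ℕ}
    (hu : HasWeight p e u w) (a : ℕ) : HasWeight p e (fun j => X ^ a * u j) (w + p * a) := by
  refine ⟨hu.1.X_pow_mul a, ?_⟩
  obtain ⟨j, hj, i, hi, rfl⟩ := hu.2
  exact ⟨j, hj, i + a, by simpa using hi, by ring⟩

/-- The vector representing the constant function `1`. -/
noncomputable def curveOne : ℕ → F[X] := fun j => if j = 0 then 1 else 0

theorem hasWeight_curveOne {e : ℕ} (hp : 2 ≤ p) : HasWeight p e (curveOne : ℕ → F[X]) 0 := by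
  refine ⟨fun j _ i hi => ?_, 0, by omega, 0, by simp [curveOne], by simp⟩
  rw [curveOne] at hi
  split_ifs at hi with h
  · rw [coeff_one] at hi
    split_ifs at hi with h'
    · simp [h, h']
    · exact absurd rfl hi
  · simp at hi

theorem hasWeight_iterate {e M : ℕ} (hp : 2 ≤ p) (he : e = 1 + p * M) {R P : F[X]}
    (hRm : R.Monic) (hPm : P.Monic) (hR : R.natDegree = M) (hP : P.natDegree = M + 1) (N : ℕ) :
    HasWeight p e ((curveMul p R P 0)^[N] curveOne) (e * N) := by
  induction N with
  | zero => simpa using hasWeight_curveOne hp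
  | succ N ih =>
    rw [Function.iterate_succ_apply', mul_add, mul_one]
    exact ih.curveMul_zero hp he hRm hPm hR hP

theorem HasWeightLE.iterate {e M : ℕ} (hp : 2 ≤ p) (he : e = 1 + p * M) {R P : F[X]}
    (hR : R.natDegree = M) (hP : P.natDegree = M + 1) (κ : F) {u : ℕ → F[X]} {w : ℕ}
    (hu : HasWeightLE p e u w) (N : ℕ) :
    HasWeightLE p e ((_root_.curveMul p R P κ)^[N] u) (w + e * N) := by
  induction N with
  | zero => simpa using hu
  | succ N ih =>
    rw [Function.iterate_succ_apply', mul_add, mul_one, ← add_assoc]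
    exact ih.curveMul hp he hR hP κ

variable {L : Type*} [Field L] [Algebra F L]

/-- The value of `∑ u_j z^j` at the point `(x, z)`. -/
noncomputable def curveEval (p : ℕ) (x z : L) (u : ℕ → F[X]) : L :=
  ∑ j ∈ Finset.range p, aeval x (u j) * z ^ j

theorem curveEval_curveMul (hp : 2 ≤ p) {R P : F[X]} (κ : F) {x z : L}
    (hz : z ^ p = aeval x R ^ (p - 1) * z + aeval x R ^ (p - 1) * aeval x P) (u : ℕ → F[X]) :
    curveEval p x z (curveMul p R P κ u) =
      (z + algebraMap F L κ * aeval x R) * curveEval p x z u := by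
  obtain ⟨m, rfl⟩ : ∃ m, p = m + 2 := ⟨p - 2, by omega⟩
  have hm : m + 2 - 1 = m + 1 := rfl
  rw [hm] at hz
  have h1 : curveEval (m + 2) x z (fun j => (if j = 0 then u (m + 2 - 1) * (R ^ (m + 2 - 1) * P)
      else if j = 1 then u 0 + u (m + 2 - 1) * R ^ (m + 2 - 1) else u (j - 1))) =
      z * curveEval (m + 2) x z u := by
    unfold curveEval
    rw [Finset.sum_range_succ', Finset.sum_range_succ', Finset.sum_range_succ,
      Finset.sum_range_succ']
    simp only [hm, if_true, zero_add, one_ne_zero, if_false, map_mul, map_add, map_pow, pow_zero,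
      pow_one, mul_one, Nat.add_eq_zero_iff, and_false, Nat.add_eq_right, Nat.add_sub_cancel]
    rw [mul_add, mul_add, Finset.mul_sum]
    have : ∀ s : ℕ, aeval x (u (s + 1)) * z ^ (s + 1 + 1) = z * (aeval x (u (s + 1)) * z ^ (s + 1)) :=
      fun s => by ring
    simp only [this]
    linear_combination (-aeval x (u (m + 1))) * hz
  have h2 : curveEval (m + 2) x z (fun j => u j * (C κ * R)) =
      algebraMap F L κ * aeval x R * curveEval (m + 2) x z u := by
    unfold curveEval
    rw [Finset.mul_sum]
    refine Finset.sum_congr rfl fun j _ => ?_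
    simp only [map_mul, aeval_C]
    ring
  rw [add_mul, ← h1, ← h2]
  unfold curveEval curveMul
  rw [← Finset.sum_add_distrib]
  refine Finset.sum_congr rfl fun j _ => ?_
  rw [map_add, add_mul]

theorem curveEval_iterate (hp : 2 ≤ p) {R P : F[X]} (κ : F) {x z : L}
    (hz : z ^ p = aeval x R ^ (p - 1) * z + aeval x R ^ (p - 1) * aeval x P) (u : ℕ → F[X])
    (N : ℕ) :
    curveEval p x z ((curveMul p R P κ)^[N] u) =
      (z + algebraMap F L κ * aeval x R) ^ N * curveEval p x z u := by
  induction N with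
  | zero => simp
  | succ N ih =>
    rw [Function.iterate_succ_apply', curveEval_curveMul hp κ hz, ih, pow_succ]; ring

theorem curveEval_one (hp : 2 ≤ p) (x z : L) : curveEval p x z (curveOne : ℕ → F[X]) = 1 := by
  unfold curveEval curveOne
  rw [Finset.sum_eq_single 0]
  · simp
  · intro j _ hj; simp [hj]
  · intro h; exact absurd (Finset.mem_range.2 (by omega)) h

end Stepanov

section StepanovBound

open Polynomial

theorem curveEval_sum_smul {p : ℕ} {F K I : Type*} [Field F] [Field K] [Algebra F K] (s : Finset I)
    (x z : K) (l : I → F) (u : I → ℕ → F[X]) :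
    curveEval p x z (fun j => ∑ i ∈ s, C (l i) * u i j) =
      ∑ i ∈ s, algebraMap F K (l i) * curveEval p x z (u i) := by
  unfold curveEval
  simp only [map_sum, map_mul, aeval_C, Finset.sum_mul, Finset.mul_sum]
  rw [Finset.sum_comm]
  refine Finset.sum_congr rfl fun i _ => Finset.sum_congr rfl fun j _ => by ring

theorem curveEval_X_pow_mul {p : ℕ} {F K : Type*} [Field F] [Field K] [Algebra F K] (x z : K) (a : ℕ)
    (u : ℕ → F[X]) :
    curveEval p x z (fun j => X ^ a * u j) = x ^ a * curveEval p x z u := by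
  unfold curveEval
  simp only [map_mul, map_pow, aeval_X, Finset.mul_sum, mul_assoc]

/-- A nontrivial linear combination of vectors of distinct weights is nonzero. -/
theorem exists_coeff_ne_zero_of_weights_injective {p : ℕ} {F I : Type*} [Field F] [Fintype I] {e : ℕ}
    (u : I → ℕ → F[X]) (w : I → ℕ) (hw : Function.Injective w)
    (hu : ∀ s, HasWeight p e (u s) (w s)) {l : I → F} (hl : l ≠ 0) :
    ∃ j < p, (∑ s, C (l s) * u s j) ≠ 0 := by
  classical
  obtain ⟨s₀, hs₀⟩ := Function.ne_iff.1 hl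
  obtain ⟨s, hs, hmax⟩ := Finset.exists_max_image (Finset.univ.filter fun s => l s ≠ 0) w
    ⟨s₀, by simpa using hs₀⟩
  obtain ⟨j, hj, i, hi, hij⟩ := (hu s).2
  refine ⟨j, hj, fun h => ?_⟩
  have h2 := congrArg (fun f => coeff f i) h
  simp only [finsetSum_coeff, coeff_C_mul, coeff_zero] at h2
  rw [Finset.sum_eq_single s] at h2
  · exact mul_ne_zero (Finset.mem_filter.1 hs).2 hi h2
  · intro t _ hts
    by_contra hne
    have hlt := left_ne_zero_of_mul hne
    have h3 := (hu t).1 j hj i (right_ne_zero_of_mul hne)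
    have h4 := hmax t (by simpa using hlt)
    exact hts (hw (by omega))
  · simp

/-- The zero-counting step of Stepanov's method: an auxiliary function vanishing at all points of
the curve above `E` bounds the size of `E`. -/
theorem card_le_of_curveEval_eq_zero {p : ℕ} {F K : Type*} [Field F] [Field K] [Algebra F K]
    {u : ℕ → F[X]} {j : ℕ} (hj : j < p) (hu : u j ≠ 0) (E : Finset K)
    (hE : ∀ x ∈ E, ∃ Z : Finset K, Z.card = p ∧ ∀ z ∈ Z, curveEval p x z u = 0) :
    E.card ≤ (u j).natDegree := by
  have hmap : (u j).map (algebraMap F K) ≠ 0 := by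
    rwa [Ne, Polynomial.map_eq_zero]
  rw [← natDegree_map (algebraMap F K)]
  refine card_le_degree_of_subset_roots (fun x hx => ?_)
  rw [mem_roots hmap]
  obtain ⟨Z, hZ, hz⟩ := hE x hx
  set g : K[X] := ∑ j ∈ Finset.range p, monomial j (aeval x (u j)) with hg
  have hg0 : g = 0 := by
    refine eq_zero_of_degree_lt_of_eval_finset_eq_zero Z ?_ ?_
    · rw [hZ, degree_lt_iff_coeff_zero]
      intro k hk
      simp only [hg, finsetSum_coeff, coeff_monomial, Finset.sum_ite_eq', Finset.mem_range]
      simp [hk]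
    · intro z hzZ
      simp only [hg, eval_finsetSum, eval_monomial]
      exact hz z hzZ
  have := congrArg (fun f => coeff f j) hg0
  simp only [hg, finsetSum_coeff, coeff_monomial, Finset.sum_ite_eq', Finset.mem_range, if_pos hj,
    coeff_zero] at this
  simpa [IsRoot.def, eval_map_algebraMap] using this

theorem pow_card_pow_of_artinSchreier {p : ℕ} [Fact p.Prime] {K : Type*} [Field K] [CharP K p]
    {y f : K} (hy : y ^ p = y + f) (n : ℕ) :
    y ^ p ^ n = y + ∑ i ∈ Finset.range n, f ^ p ^ i := by
  induction n with
  | zero => simp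
  | succ n ih =>
    rw [pow_succ', pow_mul, hy, add_pow_char_pow, ih, Finset.sum_range_succ]
    ring

variable {p : ℕ} [Fact p.Prime] {K : Type*} [Field K] [Algebra (ZMod p) K]

theorem aeval_pow_card_pow (x : K) (f : (ZMod p)[X]) (n : ℕ) :
    aeval x f ^ p ^ n = aeval (x ^ p ^ n) f := by
  induction n with
  | zero => simp
  | succ n ih =>
    rw [pow_succ, pow_mul, ih, ← map_pow, ← ZMod.expand_card, expand_aeval, ← pow_mul]

theorem algebraMap_pow_card_pow (t : ZMod p) (n : ℕ) :
    algebraMap (ZMod p) K t ^ p ^ n = algebraMap (ZMod p) K t := by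
  rw [← map_pow, ZMod.pow_card_pow]

/-- The points of the Artin–Schreier curve `y ^ p - y = P / R` above `x`, in the coordinate
`z = R y`. -/
theorem exists_curve_points [IsAlgClosed K] [CharP K p] {R P : (ZMod p)[X]} {n : ℕ} {x : K}
    {κ : ZMod p} (hx : x ^ p ^ n = x) (hRx : aeval x R ≠ 0)
    (htr : ∑ i ∈ Finset.range n, (aeval x P / aeval x R) ^ p ^ i = algebraMap (ZMod p) K κ) :
    ∃ Z : Finset K, Z.card = p ∧ ∀ z ∈ Z,
      z ^ p = aeval x R ^ (p - 1) * z + aeval x R ^ (p - 1) * aeval x P ∧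
      z ^ p ^ n = z + algebraMap (ZMod p) K κ * aeval x R := by
  classical
  have hp := (Fact.out : p.Prime)
  obtain ⟨y, hy⟩ : ∃ y : K, y ^ p = y + aeval x P / aeval x R := by
    set g : K[X] := X ^ p - X - C (aeval x P / aeval x R) with hg
    have hdeg : g.degree = p := by
      rw [hg, sub_sub, degree_sub_eq_left_of_degree_lt]
      · exact degree_X_pow p
      · rw [degree_X_pow, degree_X_add_C]
        exact_mod_cast hp.one_lt
    obtain ⟨y, hy⟩ := IsAlgClosed.exists_root g (by
      rw [hdeg]; exact_mod_cast hp.ne_zero)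
    refine ⟨y, ?_⟩
    simp only [hg, IsRoot.def, eval_sub, eval_pow, eval_X, eval_C] at hy
    linear_combination hy
  refine ⟨Finset.univ.image fun t : ZMod p => aeval x R * (y + algebraMap (ZMod p) K t), ?_, ?_⟩
  · rw [Finset.card_image_of_injective, Finset.card_univ, ZMod.card]
    intro s t hst
    have := add_left_cancel (mul_left_cancel₀ hRx hst)
    exact (algebraMap (ZMod p) K).injective this
  · intro z hz
    obtain ⟨t, -, rfl⟩ := Finset.mem_image.1 hz
    have ht := algebraMap_pow_card_pow (K := K) t
    constructor
    · have h1 := ht 1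
      rw [pow_one] at h1
      rw [mul_pow, add_pow_char, h1, hy]
      rw [← pow_sub_one_mul hp.ne_zero (aeval x R)]
      field_simp
      ring
    · rw [mul_pow, add_pow_char_pow, ht, aeval_pow_card_pow, hx,
        pow_card_pow_of_artinSchreier hy, htr]
      ring

end StepanovBound

section StepanovMain

open Polynomial

theorem stepanov_weight_injective {p e M Q' A₁ C₁ : ℕ} (hp : 0 < p) (he : e = 1 + p * M)
    (hC : C₁ + e ≤ Q') :
    Function.Injective fun s : (Fin A₁ × Fin p) × (Fin C₁ × Fin p) =>
      e * (s.2.2.1 + s.1.2.1 * (p * Q')) + p * (s.2.1.1 + s.1.1.1 * (p * Q')) := by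
  have small : ∀ {i j : ℕ}, i < C₁ → j < p → p * i + e * j < p * Q' := by
    intro i j hi hj
    have h1 : p * (i + 1 + e) ≤ p * Q' := Nat.mul_le_mul_left _ (by omega)
    have h2 : e * j ≤ e * p := Nat.mul_le_mul_left _ hj.le
    nlinarith
  have digit : ∀ {i i' j j' : ℕ}, j < p → j' < p → p * i + e * j = p * i' + e * j' →
      i = i' ∧ j = j' := by
    intro i i' j j' hj hj' h
    have h1 : (p * i + e * j) % p = j := by
      rw [he, show p * i + (1 + p * M) * j = j + p * (i + M * j) by ring, Nat.add_mul_mod_self_left,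
        Nat.mod_eq_of_lt hj]
    have h2 : (p * i' + e * j') % p = j' := by
      rw [he, show p * i' + (1 + p * M) * j' = j' + p * (i' + M * j') by ring,
        Nat.add_mul_mod_self_left, Nat.mod_eq_of_lt hj']
    have hjj : j = j' := by rw [← h1, ← h2, h]
    subst hjj
    exact ⟨Nat.eq_of_mul_eq_mul_left hp (by omega), rfl⟩
  rintro ⟨⟨⟨a, ha⟩, ⟨b, hb⟩⟩, ⟨⟨c, hc⟩, ⟨d, hd⟩⟩⟩ ⟨⟨⟨a', ha'⟩, ⟨b', hb'⟩⟩, ⟨⟨c', hc'⟩, ⟨d', hd'⟩⟩⟩ h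
  simp only at h
  have hs := small hc hd
  have hs' := small hc' hd'
  have e1 : e * (d + b * (p * Q')) + p * (c + a * (p * Q')) =
      (p * c + e * d) + (p * Q') * (p * a + e * b) := by ring
  have e2 : e * (d' + b' * (p * Q')) + p * (c' + a' * (p * Q')) =
      (p * c' + e * d') + (p * Q') * (p * a' + e * b') := by ring
  rw [e1, e2] at h
  have hq : 0 < p * Q' := by omega
  have m1 := congrArg (· % (p * Q')) h
  have m2 := congrArg (· / (p * Q')) h
  simp only [Nat.add_mul_mod_self_left, Nat.mod_eq_of_lt hs, Nat.mod_eq_of_lt hs',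
    Nat.add_mul_div_left _ _ hq, Nat.div_eq_of_lt hs, Nat.div_eq_of_lt hs', zero_add] at m1 m2
  obtain ⟨rfl, rfl⟩ := digit hd hd' m1
  obtain ⟨rfl, rfl⟩ := digit hb hb' m2
  rfl

/-- **Stepanov's bound** for the number of points of `𝔽_{p^n}` at which the rational function
`P / R` has a prescribed trace. -/
theorem stepanov_bound {p : ℕ} [Fact p.Prime] {K : Type*} [Field K] [Algebra (ZMod p) K]
    [IsAlgClosed K] [CharP K p] {R P : (ZMod p)[X]} {e M : ℕ} (he : e = 1 + p * M)
    (hRm : R.Monic) (hPm : P.Monic) (hR : R.natDegree = M) (hP : P.natDegree = M + 1)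
    {μ ν : ℕ} (hμν : μ ≤ ν) (hμ : 2 * e + 5 ≤ p ^ μ) (κ : ZMod p) (E : Finset K)
    (hE : ∀ x ∈ E, x ^ p ^ (μ + 1 + (ν + 1)) = x ∧ aeval x R ≠ 0 ∧
      ∑ i ∈ Finset.range (μ + 1 + (ν + 1)), (aeval x P / aeval x R) ^ p ^ i =
        algebraMap (ZMod p) K κ) :
    E.card ≤ p ^ μ * p ^ (ν + 1) + 7 * e * p ^ (ν + 1) := by
  classical
  have hpp := (Fact.out : p.Prime)
  have hp := hpp.two_le
  set q := p ^ μ with hq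
  set q' := p ^ ν with hq'
  have hqq' : q ≤ q' := Nat.pow_le_pow_right hpp.pos hμν
  have hQ : p ^ (μ + 1) = p * q := by rw [pow_succ, mul_comm]
  have hQ' : p ^ (ν + 1) = p * q' := by rw [pow_succ, mul_comm]
  obtain ⟨A₁, hA₁⟩ : ∃ A₁, A₁ = q + 4 * e := ⟨_, rfl⟩
  obtain ⟨C₁, hC₁⟩ : ∃ C₁, C₁ + e = q' := ⟨q' - e, by omega⟩
  have he1 : 1 ≤ e := by omega
  let I := (Fin A₁ × Fin p) × (Fin C₁ × Fin p)
  -- the functions spanning the auxiliary functions, and their restrictions to the curve points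
  let u : I → ℕ → (ZMod p)[X] := fun s j =>
    X ^ (s.2.1.1 + s.1.1.1 * (p * q')) *
      ((curveMul p R P 0)^[s.2.2.1 + s.1.2.1 * (p * q')] curveOne) j
  let v : I → ℕ → (ZMod p)[X] := fun s j =>
    X ^ (s.1.1.1 + s.2.1.1 * (p * q)) *
      ((curveMul p R P κ)^[s.1.2.1] ((curveMul p R P 0)^[s.2.2.1 * (p * q)] curveOne)) j
  have hu : ∀ s, HasWeight p e (u s)
      (e * (s.2.2.1 + s.1.2.1 * (p * q')) + p * (s.2.1.1 + s.1.1.1 * (p * q'))) := fun s =>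
    (hasWeight_iterate hp he hRm hPm hR hP _).X_pow_mul _
  have hv : ∀ s, HasWeightLE p e (v s)
      (e * (s.2.2.1 * (p * q)) + e * s.1.2.1 + p * (s.1.1.1 + s.2.1.1 * (p * q))) := fun s =>
    ((hasWeight_iterate hp he hRm hPm hR hP _).1.iterate hp he hR hP κ _).X_pow_mul _
  obtain ⟨N, hN⟩ : ∃ N, N = A₁ + C₁ * (p * q) - p * q + e * (p * q + 1) := ⟨_, rfl⟩
  have hC₁pos : 1 ≤ C₁ := by omega
  have hN' : N + p * q = A₁ + C₁ * (p * q) + e * (p * q + 1) := by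
    have : p * q ≤ C₁ * (p * q) := Nat.le_mul_of_pos_left _ hC₁pos
    omega
  have hvN : ∀ s, ∀ j < p, ∀ i, (v s j).coeff i ≠ 0 → i < N := by
    rintro ⟨⟨⟨a, ha⟩, ⟨b, hb⟩⟩, ⟨⟨c, hc⟩, ⟨d, hd⟩⟩⟩ j hj i hi
    have h1 := hv _ j hj i hi
    simp only at h1
    have hb' : b + 1 ≤ p := hb
    have hd' : d + 1 ≤ p := hd
    have h2 : e * (d * (p * q)) + e * b + e * (p * q + 1) ≤ e * (p * (p * q + 1)) := by
      have h3 : e * ((d + 1) * (p * q)) ≤ e * (p * (p * q)) := by gcongr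
      have h4 : e * (b + 1) ≤ e * p := by gcongr
      nlinarith
    have h5 : p * (a + c * (p * q)) + p * (1 + p * q) ≤ p * (A₁ + C₁ * (p * q)) := by
      have h6 : (c + 1) * (p * q) ≤ C₁ * (p * q) := Nat.mul_le_mul_right _ hc
      have h7 : a + c * (p * q) + (1 + p * q) ≤ A₁ + C₁ * (p * q) := by nlinarith
      calc _ = p * (a + c * (p * q) + (1 + p * q)) := by ring
        _ ≤ _ := Nat.mul_le_mul_left _ h7
    have h8 : p * i + p * (1 + p * q) ≤ p * (N + p * q) := by
      rw [hN', mul_add p _ (e * _)]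
      have : p * (e * (p * q + 1)) = e * (p * (p * q + 1)) := by ring
      have h9 : e * j + e * (p * q + 1) ≥ 0 := Nat.zero_le _
      omega
    have h10 := Nat.le_of_mul_le_mul_left
      (show p * (i + (1 + p * q)) ≤ p * (N + p * q) by rw [mul_add]; exact h8) hpp.pos
    omega
  have hcard : Fintype.card (Fin p × Fin N) < Fintype.card I := by
    simp only [I, Fintype.card_prod, Fintype.card_fin]
    have h1 : N < p * (A₁ * C₁) := by
      have h2 : q ≤ 2 * C₁ := by omega
      have h3 : p * (A₁ * C₁) = C₁ * (p * q) + 4 * (e * (p * C₁)) := by rw [hA₁]; ring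
      have h4 : e * (p * q) ≤ 2 * (e * (p * C₁)) := by
        calc e * (p * q) ≤ e * (p * (2 * C₁)) := by gcongr
          _ = _ := by ring
      have h5 : q ≤ p * q := Nat.le_mul_of_pos_left _ hpp.pos
      have h6 : e * 10 ≤ e * (p * q) := by
        apply Nat.mul_le_mul_left
        calc 10 ≤ 2 * q := by omega
          _ ≤ p * q := Nat.mul_le_mul_right _ hp
      have h7 : e * (p * q + 1) = e * (p * q) + e := by ring
      omega
    calc p * N < p * (p * (A₁ * C₁)) := Nat.mul_lt_mul_of_pos_left h1 hpp.pos
      _ = _ := by ring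
  obtain ⟨l, hl0, hl⟩ := exists_nontrivial_relation_of_card_lt
    (fun (ji : Fin p × Fin N) (s : I) => (v s ji.1).coeff ji.2) hcard
  have hvzero : ∀ j < p, ∑ s, C (l s) * v s j = 0 := by
    intro j hj
    ext i
    simp only [finsetSum_coeff, coeff_C_mul, coeff_zero]
    by_cases hi : i < N
    · exact hl (⟨j, hj⟩, ⟨i, hi⟩)
    · refine Finset.sum_eq_zero fun s _ => ?_
      by_contra hne
      exact hi (hvN s j hj i (right_ne_zero_of_mul hne))
  obtain ⟨j, hj, hne⟩ := exists_coeff_ne_zero_of_weights_injective u _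
    (stepanov_weight_injective hpp.pos he hC₁.le) hu hl0
  refine (card_le_of_curveEval_eq_zero (u := fun j => ∑ s, C (l s) * u s j) hj hne E ?_).trans ?_
  · intro x hx
    obtain ⟨hx1, hx2, hx3⟩ := hE x hx
    obtain ⟨Z, hZ, hz⟩ := exists_curve_points hx1 hx2 hx3
    refine ⟨Z, hZ, fun z hzZ => ?_⟩
    obtain ⟨hz1, hz2⟩ := hz z hzZ
    have hz1' := hz1
    rw [pow_add] at hx1 hz2
    have hv0 : curveEval p x z (fun j => ∑ s, C (l s) * v s j) = 0 :=
      Finset.sum_eq_zero fun j hj => by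
        beta_reduce; rw [hvzero j (Finset.mem_range.1 hj), map_zero, zero_mul]
    have hpow : curveEval p x z (fun j => ∑ s, C (l s) * u s j) ^ p ^ (μ + 1) = 0 := by
      rw [← hv0, curveEval_sum_smul, curveEval_sum_smul, sum_pow_char_pow]
      refine Finset.sum_congr rfl fun s _ => ?_
      rw [mul_pow, algebraMap_pow_card_pow, curveEval_X_pow_mul, curveEval_X_pow_mul,
        curveEval_iterate hp 0 hz1, curveEval_iterate hp κ hz1, curveEval_iterate hp 0 hz1,
        curveEval_one hp]
      simp only [map_zero, zero_mul, add_zero, mul_one]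
      rw [← hz2, ← hQ, ← hQ']
      congr 1
      rw [mul_pow]
      have hxx : (x ^ (s.2.1.1 + s.1.1.1 * p ^ (ν + 1))) ^ p ^ (μ + 1) =
          x ^ (s.1.1.1 + s.2.1.1 * p ^ (μ + 1)) := by
        calc _ = (x ^ (p ^ (μ + 1) * p ^ (ν + 1))) ^ s.1.1.1 * x ^ (s.2.1.1 * p ^ (μ + 1)) := by ring
          _ = _ := by rw [hx1, ← pow_add]
      rw [hxx]
      ring
    exact eq_zero_of_pow_eq_zero hpow
  · rw [natDegree_le_iff_coeff_eq_zero]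
    intro i hi
    simp only [finsetSum_coeff, coeff_C_mul]
    refine Finset.sum_eq_zero fun s _ => ?_
    by_contra hne'
    have h1 := (hu s).1 j hj i (right_ne_zero_of_mul hne')
    obtain ⟨⟨⟨a, ha⟩, ⟨b, hb⟩⟩, ⟨⟨c, hc⟩, ⟨d, hd⟩⟩⟩ := s
    simp only at h1
    have h2 : p * i ≤ p * (e * (1 + p * q') + (q' + (q + 4 * e) * (p * q'))) := by
      calc p * i ≤ e * (d + b * (p * q')) + p * (c + a * (p * q')) := by omega
        _ ≤ e * (p + p * (p * q')) + p * (q' + (q + 4 * e) * (p * q')) := by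
          gcongr <;> omega
        _ = _ := by ring
    have h3 := Nat.le_of_mul_le_mul_left h2 hpp.pos
    have h4 : 1 ≤ p * q' := Nat.mul_pos hpp.pos (by omega)
    have h5 : e * 1 ≤ e * (p * q') := Nat.mul_le_mul_left _ h4
    have h6 : q' ≤ p * q' := Nat.le_mul_of_pos_left _ hpp.pos
    have h7 : 1 * (p * q') ≤ e * (p * q') := Nat.mul_le_mul_right _ he1
    have h8 : e * (1 + p * q') + (q' + (q + 4 * e) * (p * q')) =
        e + q' + q * (p * q') + 5 * (e * (p * q')) := by ring
    rw [hQ', mul_assoc] at hi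
    omega

end StepanovMain

set_option linter.unusedSectionVars false

section FrobeniusOrbits

open Polynomial

variable {p : ℕ} [Fact p.Prime] {K : Type*} [Field K] [Algebra (ZMod p) K]

theorem mem_range_algebraMap_of_pow_card [CharP K p] {y : K} (hy : y ^ p = y) :
    ∃ t : ZMod p, algebraMap (ZMod p) K t = y := by
  have h := (Subfield.mem_bot_iff_pow_eq_self K p).2 hy
  rw [← ZMod.fieldRange_castHom_eq_bot p] at h
  obtain ⟨t, ht⟩ := h
  refine ⟨t, ?_⟩
  rw [← ht]
  exact congrArg (fun f : ZMod p →+* K => f t) (Subsingleton.elim _ _)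

/-- The elements of `K` fixed by the `j`-th power of the Frobenius (empty for `j = 0`). -/
noncomputable def frobFixed (p : ℕ) (K : Type*) [Field K] (j : ℕ) : Finset K := by
  classical exact ((X ^ p ^ j - X : K[X]).roots).toFinset

/-- The product of `X - x ^ p ^ i` over `i < j`. -/
noncomputable def frobPoly (p : ℕ) {K : Type*} [Field K] (x : K) (j : ℕ) : K[X] :=
  ∏ i ∈ Finset.range j, (X - C (x ^ p ^ i))

theorem frobFixed_zero : frobFixed p K 0 = ∅ := by
  simp [frobFixed]

theorem mem_frobFixed {j : ℕ} (hj : j ≠ 0) {x : K} : x ∈ frobFixed p K j ↔ x ^ p ^ j = x := by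
  have h1 : 1 < p ^ j := Nat.one_lt_pow hj (Fact.out : p.Prime).one_lt
  simp [frobFixed, FiniteField.X_pow_card_sub_X_ne_zero K h1, sub_eq_zero]

theorem pow_eq_self_of_mem_frobFixed {j : ℕ} {x : K} (hx : x ∈ frobFixed p K j) :
    x ^ p ^ j = x := by
  rcases eq_or_ne j 0 with rfl | hj
  · simp
  · exact (mem_frobFixed hj).1 hx

theorem card_frobFixed [CharP K p] [IsAlgClosed K] {j : ℕ} (hj : j ≠ 0) :
    (frobFixed p K j).card = p ^ j := by
  classical
  have h1 : 1 < p ^ j := Nat.one_lt_pow hj (Fact.out : p.Prime).one_lt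
  unfold frobFixed
  rw [Multiset.toFinset_card_of_nodup, (IsAlgClosed.splits _).natDegree_eq_card_roots.symm]
  · exact FiniteField.X_pow_card_sub_X_natDegree_eq K h1
  · exact nodup_roots (galois_poly_separable p _ (dvd_pow_self p hj))

theorem frobPoly_monic (x : K) (j : ℕ) : (frobPoly p x j).Monic :=
  monic_prod_of_monic _ _ fun _ _ => monic_X_sub_C _

theorem natDegree_frobPoly (x : K) (j : ℕ) : (frobPoly p x j).natDegree = j := by
  rw [frobPoly, natDegree_prod_of_monic _ _ fun _ _ => monic_X_sub_C _]
  simp only [natDegree_X_sub_C, Finset.sum_const, Finset.card_range, smul_eq_mul, mul_one]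

theorem frobPoly_map_frobenius [CharP K p] {x : K} {j : ℕ} (hx : x ^ p ^ j = x) :
    (frobPoly p x j).map (frobenius K p) = frobPoly p x j := by
  have h1 : (frobPoly p x j).map (frobenius K p)
      = ∏ i ∈ Finset.range j, (X - C (x ^ p ^ (i + 1))) := by
    simp only [frobPoly, Polynomial.map_prod, Polynomial.map_sub, map_X, map_C, frobenius_def,
      ← pow_mul, pow_succ]
  have h2 := Finset.prod_range_succ (fun i => (X - C (x ^ p ^ i) : K[X])) j
  rw [Finset.prod_range_succ'] at h2
  simp only [hx, pow_zero, pow_one] at h2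
  rw [h1]
  exact mul_right_cancel₀ (X_sub_C_ne_zero x) h2

theorem exists_map_eq_frobPoly [CharP K p] {x : K} {j : ℕ} (hx : x ^ p ^ j = x) :
    ∃ g : (ZMod p)[X], g.map (algebraMap (ZMod p) K) = frobPoly p x j := by
  have h : frobPoly p x j ∈ lifts (algebraMap (ZMod p) K) := by
    rw [lifts_iff_coeff_lifts]
    intro n
    obtain ⟨t, ht⟩ := mem_range_algebraMap_of_pow_card (p := p)
      (y := (frobPoly p x j).coeff n) (by
        conv_rhs => rw [← frobPoly_map_frobenius hx]
        rw [coeff_map, frobenius_def])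
    exact ⟨t, ht⟩
  exact (mem_lifts _).1 h

open Classical in
/-- The polynomial over the prime field that becomes `frobPoly p x j` over `K`. -/
noncomputable def frobDescent (p : ℕ) [Fact p.Prime] {K : Type*} [Field K] [Algebra (ZMod p) K]
    (x : K) (j : ℕ) : (ZMod p)[X] :=
  if h : ∃ g : (ZMod p)[X], g.map (algebraMap (ZMod p) K) = frobPoly p x j then h.choose else 0

theorem map_frobDescent [CharP K p] {x : K} {j : ℕ} (hx : x ^ p ^ j = x) :
    (frobDescent p x j).map (algebraMap (ZMod p) K) = frobPoly p x j := by
  have h := exists_map_eq_frobPoly hx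
  rw [frobDescent, dif_pos h]
  exact h.choose_spec

theorem frobDescent_monic [CharP K p] {x : K} {j : ℕ} (hx : x ^ p ^ j = x) :
    (frobDescent p x j).Monic := by
  apply monic_of_injective (algebraMap (ZMod p) K).injective
  rw [map_frobDescent hx]
  exact frobPoly_monic x j

theorem natDegree_frobDescent [CharP K p] {x : K} {j : ℕ} (hx : x ^ p ^ j = x) :
    (frobDescent p x j).natDegree = j := by
  rw [← natDegree_map_eq_of_injective (algebraMap (ZMod p) K).injective, map_frobDescent hx,
    natDegree_frobPoly]

theorem frobPoly_mul {x : K} {D : ℕ} (hx : x ^ p ^ D = x) (n : ℕ) :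
    frobPoly p x (D * n) = frobPoly p x D ^ n := by
  have hn : ∀ n, x ^ p ^ (D * n) = x := by
    intro n
    induction n with
    | zero => simp
    | succ n ih => rw [mul_add, mul_one, pow_add, pow_mul, ih, hx]
  induction n with
  | zero => simp [frobPoly]
  | succ n ih =>
    rw [pow_succ, ← ih, mul_add, mul_one, frobPoly, Finset.prod_range_add]
    congr 1
    refine Finset.prod_congr rfl fun i _ => ?_
    rw [pow_add, pow_mul, hn]

theorem rootMultiplicity_pow_card [CharP K p] (g : (ZMod p)[X]) (x : K) (n : ℕ) :
    rootMultiplicity (x ^ p ^ n) (g.map (algebraMap (ZMod p) K))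
      = rootMultiplicity x (g.map (algebraMap (ZMod p) K)) := by
  induction n with
  | zero => simp
  | succ n ih =>
    have hmap : (g.map (algebraMap (ZMod p) K)).map (frobenius K p)
        = g.map (algebraMap (ZMod p) K) := by
      rw [Polynomial.map_map]
      congr 1
      exact Subsingleton.elim _ _
    rw [← ih, eq_rootMultiplicity_map (frobenius K p).injective (x ^ p ^ n), hmap, frobenius_def,
      ← pow_mul, ← pow_succ]

theorem frobPoly_mul_dvd_iff [CharP K p] {g : (ZMod p)[X]} (hg : g ≠ 0) {x : K} {D : ℕ}
    (hD : 0 < D) (hx : x ^ p ^ D = x)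
    (hinj : Set.InjOn (fun i => x ^ p ^ i) (Set.Iio D)) (n : ℕ) :
    frobPoly p x (D * n) ∣ g.map (algebraMap (ZMod p) K) ↔
      n ≤ rootMultiplicity x (g.map (algebraMap (ZMod p) K)) := by
  have hg' : g.map (algebraMap (ZMod p) K) ≠ 0 :=
    (Polynomial.map_ne_zero_iff (algebraMap (ZMod p) K).injective).2 hg
  rw [frobPoly_mul hx]
  constructor
  · intro h
    rw [le_rootMultiplicity_iff hg']
    refine (pow_dvd_pow_of_dvd ?_ n).trans h
    have := Finset.dvd_prod_of_mem (fun i => (X - C (x ^ p ^ i) : K[X]))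
      (Finset.mem_range.2 hD)
    rwa [pow_zero, pow_one] at this
  · intro h
    rw [frobPoly, ← Finset.prod_pow]
    apply Finset.prod_dvd_of_coprime
    · intro i hi j hj hij
      apply IsCoprime.pow
      apply isCoprime_X_sub_C_of_isUnit_sub
      rw [isUnit_iff_ne_zero, sub_ne_zero]
      intro he
      exact hij (hinj (by simpa using hi) (by simpa using hj) he)
    · intro i _
      rw [← le_rootMultiplicity_iff hg', rootMultiplicity_pow_card]
      exact h

theorem exists_minimal_frobenius_period [CharP K p] {g : (ZMod p)[X]} (hg : g ≠ 0) {x : K}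
    (hx : x ∈ (g.map (algebraMap (ZMod p) K)).roots) :
    ∃ D, 0 < D ∧ Set.InjOn (fun i => x ^ p ^ i) (Set.Iio D) ∧ ∀ j, x ^ p ^ j = x ↔ D ∣ j := by
  classical
  set G := g.map (algebraMap (ZMod p) K)
  have hG : G ≠ 0 := (Polynomial.map_ne_zero_iff (algebraMap (ZMod p) K).injective).2 hg
  have hit : ∀ j, (frobenius K p)^[j] x = x ^ p ^ j := fun j => iterate_frobenius ..
  have hper : x ∈ Function.periodicPts (frobenius K p) := by
    have hmaps : Set.MapsTo (fun i : ℕ => x ^ p ^ i) Set.univ (G.roots.toFinset : Set K) := by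
      intro i _
      simp only [Finset.mem_coe, Multiset.mem_toFinset]
      rw [← Multiset.count_pos, count_roots, rootMultiplicity_pow_card, ← count_roots,
        Multiset.count_pos]
      exact hx
    obtain ⟨i, -, j, -, hij, he⟩ := Set.infinite_univ.exists_lt_map_eq_of_mapsTo hmaps
      (Finset.finite_toSet _)
    refine ⟨j - i, Nat.sub_pos_of_lt hij, ?_⟩
    change (frobenius K p)^[j - i] x = x
    apply ((frobenius K p).injective.iterate i)
    rw [← Function.iterate_add_apply, Nat.add_sub_cancel' hij.le, hit, hit]
    exact he.symm
  refine ⟨Function.minimalPeriod (frobenius K p) x, Function.minimalPeriod_pos_of_mem_periodicPts hper,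
    ?_, fun j => ?_⟩
  · intro i hi j hj he
    refine Function.iterate_injOn_Iio_minimalPeriod hi hj ?_
    simp only [hit]
    exact he
  · rw [← Function.isPeriodicPt_iff_minimalPeriod_dvd, ← hit]
    rfl

theorem sum_card_frobDescent_dvd [CharP K p] [IsAlgClosed K] [DecidableEq K]
    {g : (ZMod p)[X]} (hg : g.Monic) {d : ℕ} (hd : g.natDegree = d)
    [∀ j, DecidablePred fun x : K => frobDescent p x j ∣ g] :
    ∑ j ∈ Finset.range (d + 1), ((frobFixed p K j).filter fun x => frobDescent p x j ∣ g).card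
      = d := by
  classical
  set G := g.map (algebraMap (ZMod p) K) with hGdef
  have hG : G ≠ 0 := (Polynomial.map_ne_zero_iff (algebraMap (ZMod p) K).injective).2 hg.ne_zero
  have hGd : G.natDegree = d := by
    rw [hGdef, natDegree_map_eq_of_injective (algebraMap (ZMod p) K).injective, hd]
  have hdvd : ∀ j x, x ∈ frobFixed p K j → (frobDescent p x j ∣ g ↔ frobPoly p x j ∣ G) := by
    intro j x hx
    rw [← map_frobDescent (pow_eq_self_of_mem_frobFixed hx), hGdef]
    exact (map_dvd_map' _).symm
  have hfilter : ∀ j, ((frobFixed p K j).filter fun x => frobDescent p x j ∣ g)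
      = G.roots.toFinset.filter fun x => j ≠ 0 ∧ x ^ p ^ j = x ∧ frobPoly p x j ∣ G := by
    intro j
    ext x
    simp only [Finset.mem_filter, Multiset.mem_toFinset]
    constructor
    · rintro ⟨hx, h⟩
      have hj : j ≠ 0 := by
        rintro rfl
        simp [frobFixed_zero] at hx
      have h' := (hdvd j x hx).1 h
      refine ⟨?_, hj, pow_eq_self_of_mem_frobFixed hx, h'⟩
      rw [mem_roots hG, ← dvd_iff_isRoot]
      refine dvd_trans ?_ h'
      have := Finset.dvd_prod_of_mem (fun i => (X - C (x ^ p ^ i) : K[X]))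
        (Finset.mem_range.2 (Nat.pos_of_ne_zero hj))
      rwa [pow_zero, pow_one] at this
    · rintro ⟨-, hj, hx, h⟩
      have hx' := (mem_frobFixed (p := p) hj).2 hx
      exact ⟨hx', (hdvd j x hx').2 h⟩
  have hswap : ∑ j ∈ Finset.range (d + 1),
      ((frobFixed p K j).filter fun x => frobDescent p x j ∣ g).card
      = ∑ x ∈ G.roots.toFinset, ((Finset.range (d + 1)).filter fun j =>
          j ≠ 0 ∧ x ^ p ^ j = x ∧ frobPoly p x j ∣ G).card := by
    simp only [hfilter, Finset.card_filter]
    exact Finset.sum_comm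
  rw [hswap]
  have hx : ∀ x ∈ G.roots.toFinset, ((Finset.range (d + 1)).filter fun j =>
      j ≠ 0 ∧ x ^ p ^ j = x ∧ frobPoly p x j ∣ G).card = G.roots.count x := by
    intro x hx
    rw [Multiset.mem_toFinset] at hx
    obtain ⟨D, hD, hinj, hper⟩ := exists_minimal_frobenius_period hg.ne_zero hx
    have hxD : x ^ p ^ D = x := (hper D).2 dvd_rfl
    have heq : ((Finset.range (d + 1)).filter fun j =>
        j ≠ 0 ∧ x ^ p ^ j = x ∧ frobPoly p x j ∣ G)
        = (Finset.Icc 1 (rootMultiplicity x G)).image fun n => D * n := by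
      ext j
      simp only [Finset.mem_filter, Finset.mem_range, Finset.mem_image, Finset.mem_Icc]
      constructor
      · rintro ⟨-, hj, hxj, h⟩
        obtain ⟨n, rfl⟩ := (hper j).1 hxj
        refine ⟨n, ⟨?_, (frobPoly_mul_dvd_iff hg.ne_zero hD hxD hinj n).1 h⟩, rfl⟩
        exact Nat.pos_of_ne_zero fun h0 => hj (by simp [h0])
      · rintro ⟨n, ⟨hn1, hn⟩, rfl⟩
        have h := (frobPoly_mul_dvd_iff hg.ne_zero hD hxD hinj n).2 hn
        refine ⟨?_, (Nat.mul_pos hD hn1).ne', (hper _).2 (dvd_mul_right _ _), h⟩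
        have := natDegree_le_of_dvd h hG
        rw [natDegree_frobPoly] at this
        change _ ≤ G.natDegree at this
        omega
    rw [heq, Finset.card_image_of_injective _ fun a b h => Nat.eq_of_mul_eq_mul_left hD h,
      Nat.card_Icc, count_roots]
    simp
  rw [Finset.sum_congr rfl hx, Multiset.toFinset_sum_count_eq,
    (IsAlgClosed.splits G).natDegree_eq_card_roots.symm, hGd]

end FrobeniusOrbits

section LogSum

open Polynomial

variable {k ι : Type*} [Field k]

/-- For `g = ∏ (X - x)`, this is the sum over the roots of `x + ∑ w i / (x - a i)`. -/
noncomputable def logSum (s : Finset ι) (a w : ι → k) (g : k[X]) : k :=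
  -g.nextCoeff - ∑ i ∈ s, w i * (g.derivative.eval (a i) / g.eval (a i))

theorem logSum_mul (s : Finset ι) (a w : ι → k) {f g : k[X]} (hf : f.Monic) (hg : g.Monic)
    (hf0 : ∀ i ∈ s, f.eval (a i) ≠ 0) (hg0 : ∀ i ∈ s, g.eval (a i) ≠ 0) :
    logSum s a w (f * g) = logSum s a w f + logSum s a w g := by
  have h : ∑ i ∈ s, w i * ((f * g).derivative.eval (a i) / (f * g).eval (a i))
      = ∑ i ∈ s, w i * (f.derivative.eval (a i) / f.eval (a i))
        + ∑ i ∈ s, w i * (g.derivative.eval (a i) / g.eval (a i)) := by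
    rw [← Finset.sum_add_distrib]
    refine Finset.sum_congr rfl fun i hi => ?_
    have h1 := hf0 i hi
    have h2 := hg0 i hi
    simp only [derivative_mul, eval_add, eval_mul]
    field_simp
  rw [logSum, logSum, logSum, h, hf.nextCoeff_mul hg]
  ring

theorem logSum_one (s : Finset ι) (a w : ι → k) : logSum s a w 1 = 0 := by
  simp [logSum, nextCoeff]

theorem logSum_X_sub_C (s : Finset ι) (a w : ι → k) (x : k) :
    logSum s a w (X - C x) = x + ∑ i ∈ s, w i / (x - a i) := by
  rw [logSum, nextCoeff_X_sub_C, neg_neg, sub_eq_add_neg, ← Finset.sum_neg_distrib]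
  congr 1
  refine Finset.sum_congr rfl fun i _ => ?_
  simp only [derivative_sub, derivative_X, derivative_C, sub_zero, eval_one, eval_sub, eval_X,
    eval_C]
  rw [← neg_sub x (a i), div_neg, mul_neg, neg_neg, mul_one_div]

theorem logSum_prod (s : Finset ι) (a w : ι → k) (x : ℕ → k) (j : ℕ)
    (h : ∀ i ∈ s, ∀ m < j, x m ≠ a i) :
    logSum s a w (∏ m ∈ Finset.range j, (X - C (x m)))
      = ∑ m ∈ Finset.range j, (x m + ∑ i ∈ s, w i / (x m - a i)) := by
  induction j with
  | zero => simp [logSum_one]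
  | succ j ih =>
    rw [Finset.prod_range_succ, Finset.sum_range_succ, logSum_mul, ih, logSum_X_sub_C]
    · exact fun i hi m hm => h i hi m (by omega)
    · exact monic_prod_of_monic _ _ fun _ _ => monic_X_sub_C _
    · exact monic_X_sub_C _
    · intro i hi
      rw [eval_prod, Finset.prod_ne_zero_iff]
      intro m hm
      rw [eval_sub, eval_X, eval_C, sub_ne_zero]
      exact (h i hi m (by simp only [Finset.mem_range] at hm; omega)).symm
    · intro i hi
      rw [eval_sub, eval_X, eval_C, sub_ne_zero]
      exact (h i hi j (by omega)).symm

theorem logSum_map {K : Type*} [Field K] (φ : k →+* K) (s : Finset ι) (a w : ι → k) (g : k[X]) :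
    φ (logSum s a w g) = logSum s (fun i => φ (a i)) (fun i => φ (w i)) (g.map φ) := by
  simp only [logSum, map_sub, map_neg, map_sum, map_mul, map_div₀, derivative_map,
    eval_map_apply, nextCoeff_map φ.injective]

/-- The multiplicative character on monic polynomials attached to an additive character. -/
noncomputable def poleChar (ψ : AddChar k ℂ) (s : Finset ι) (a w : ι → k) (g : k[X]) : ℂ := by
  classical exact if ∀ i ∈ s, g.eval (a i) ≠ 0 then ψ (logSum s a w g) else 0

theorem poleChar_of_ne_zero (ψ : AddChar k ℂ) {s : Finset ι} {a : ι → k} (w : ι → k) {g : k[X]}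
    (h : ∀ i ∈ s, g.eval (a i) ≠ 0) : poleChar ψ s a w g = ψ (logSum s a w g) := by
  rw [poleChar, if_pos h]

theorem poleChar_of_eq_zero (ψ : AddChar k ℂ) {s : Finset ι} {a : ι → k} (w : ι → k) {g : k[X]}
    {i : ι} (hi : i ∈ s) (h : g.eval (a i) = 0) : poleChar ψ s a w g = 0 := by
  rw [poleChar, if_neg]
  exact fun H => H i hi h

theorem poleChar_mul (ψ : AddChar k ℂ) (s : Finset ι) (a w : ι → k) {f g : k[X]} (hf : f.Monic)
    (hg : g.Monic) : poleChar ψ s a w (f * g) = poleChar ψ s a w f * poleChar ψ s a w g := by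
  by_cases hf0 : ∀ i ∈ s, f.eval (a i) ≠ 0
  · by_cases hg0 : ∀ i ∈ s, g.eval (a i) ≠ 0
    · rw [poleChar_of_ne_zero ψ w hf0, poleChar_of_ne_zero ψ w hg0, poleChar_of_ne_zero ψ w,
        logSum_mul s a w hf hg hf0 hg0, AddChar.map_add_eq_mul]
      intro i hi
      rw [eval_mul]
      exact mul_ne_zero (hf0 i hi) (hg0 i hi)
    · push Not at hg0
      obtain ⟨i, hi, h⟩ := hg0
      rw [poleChar_of_eq_zero ψ w hi h, mul_zero, poleChar_of_eq_zero ψ w hi]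
      rw [eval_mul, h, mul_zero]
  · push Not at hf0
    obtain ⟨i, hi, h⟩ := hf0
    rw [poleChar_of_eq_zero ψ w hi h, zero_mul, poleChar_of_eq_zero ψ w hi]
    rw [eval_mul, h, zero_mul]

theorem poleChar_one (ψ : AddChar k ℂ) (s : Finset ι) (a w : ι → k) :
    poleChar ψ s a w 1 = 1 := by
  rw [poleChar_of_ne_zero ψ w (by simp), logSum_one, AddChar.map_zero_eq_one]

end LogSum

section Monics

open Polynomial

variable {k ι : Type*} [Field k] [Finite k]

theorem finite_monics (k : Type*) [Field k] [Finite k] (d : ℕ) :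
    {g : k[X] | g.Monic ∧ g.natDegree = d}.Finite := by
  have : {g : k[X] | g.Monic ∧ g.natDegree = d} ⊆
      Set.range fun v : Fin d → k => X ^ d + ∑ i : Fin d, C (v i) * X ^ (i : ℕ) := by
    rintro g ⟨hg, rfl⟩
    refine ⟨fun i => g.coeff i, ?_⟩
    conv_rhs => rw [hg.as_sum]
    simp only
    rw [Fin.sum_univ_eq_sum_range (fun i => C (g.coeff i) * X ^ i)]
  exact (Set.finite_range _).subset this

/-- The monic polynomials of degree `d` over a finite field. -/
noncomputable def monics (k : Type*) [Field k] [Finite k] (d : ℕ) : Finset k[X] :=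
  (finite_monics k d).toFinset

theorem mem_monics {d : ℕ} {g : k[X]} : g ∈ monics k d ↔ g.Monic ∧ g.natDegree = d := by
  simp [monics]

theorem sum_monics_zero (χ : k[X] → ℂ) : ∑ g ∈ monics k 0, χ g = χ 1 := by
  have : monics k 0 = {1} := by
    ext g
    rw [mem_monics, Finset.mem_singleton]
    constructor
    · rintro ⟨hg, h⟩
      exact eq_one_of_monic_natDegree_zero hg h
    · rintro rfl
      simp [monic_one]
  rw [this, Finset.sum_singleton]

theorem sum_monics_one [Fintype k] (χ : k[X] → ℂ) :
    ∑ g ∈ monics k 1, χ g = ∑ x : k, χ (X - C x) := by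
  symm
  refine Finset.sum_bij (fun x _ => X - C x) ?_ ?_ ?_ ?_
  · intro x _
    exact mem_monics.2 ⟨monic_X_sub_C x, natDegree_X_sub_C x⟩
  · intro x _ y _ h
    exact C_injective (sub_right_injective h)
  · intro g hg
    obtain ⟨hg, hd⟩ := mem_monics.1 hg
    refine ⟨-g.coeff 0, Finset.mem_univ _, ?_⟩
    conv_rhs => rw [hg.as_sum, hd]
    simp
  · intro x _
    rfl

theorem sum_monics_poleChar_eq_zero {ψ : AddChar k ℂ} (hψ : ψ ≠ 1) (s : Finset ι) (a w : ι → k)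
    {d : ℕ} (hd : 2 * s.card < d) : ∑ g ∈ monics k d, poleChar ψ s a w g = 0 := by
  obtain ⟨t, ht⟩ : ∃ t, ψ t ≠ 1 := by
    by_contra! h
    exact hψ (by ext t; simpa using h t)
  set R : k[X] := ∏ i ∈ s, (X - C (a i)) with hR
  have hRm : R.Monic := monic_prod_of_monic _ _ fun _ _ => monic_X_sub_C _
  have hRd : R.natDegree = s.card := by
    rw [hR, natDegree_prod_of_monic _ _ fun _ _ => monic_X_sub_C _]
    simp only [natDegree_X_sub_C, Finset.sum_const, smul_eq_mul, mul_one]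
  have hR0 : ∀ i ∈ s, R.eval (a i) = 0 := by
    intro i hi
    rw [hR, eval_prod]
    exact Finset.prod_eq_zero hi (by simp)
  set Q : k[X] := R ^ 2 * X ^ (d - 1 - 2 * s.card) with hQ
  have hQm : Q.Monic := (hRm.pow 2).mul (monic_X_pow _)
  have hQd : Q.natDegree = d - 1 := by
    rw [hQ, (hRm.pow 2).natDegree_mul (monic_X_pow _), hRm.natDegree_pow, hRd, natDegree_X_pow]
    omega
  have hQ0 : ∀ i ∈ s, Q.eval (a i) = 0 := fun i hi => by simp [hQ, hR0 i hi]
  have hQ1 : ∀ i ∈ s, Q.derivative.eval (a i) = 0 := fun i hi => by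
    simp [hQ, derivative_mul, derivative_pow, hR0 i hi]
  have hdeg : ∀ (u : k) (g : k[X]), g.Monic → g.natDegree = d → (C u * Q).degree < g.degree := by
    intro u g hg hgd
    apply degree_lt_degree
    have := natDegree_C_mul_le u Q
    omega
  have hmem : ∀ (u : k) (g : k[X]), g ∈ monics k d → g + C u * Q ∈ monics k d := by
    intro u g hg
    obtain ⟨hgm, hgd⟩ := mem_monics.1 hg
    refine mem_monics.2 ⟨hgm.add_of_left (hdeg u g hgm hgd), ?_⟩
    rw [← hgd]
    exact natDegree_eq_of_degree_eq (degree_add_eq_left_of_degree_lt (hdeg u g hgm hgd))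
  have hχ : ∀ g ∈ monics k d, poleChar ψ s a w (g + C (-t) * Q) = ψ t * poleChar ψ s a w g := by
    intro g hg
    have hev : ∀ i ∈ s, (g + C (-t) * Q).eval (a i) = g.eval (a i) := by
      intro i hi
      simp [hQ0 i hi]
    have hev' : ∀ i ∈ s, (g + C (-t) * Q).derivative.eval (a i) = g.derivative.eval (a i) := by
      intro i hi
      rw [derivative_add, derivative_C_mul, eval_add, eval_mul, hQ1 i hi, mul_zero, add_zero]
    by_cases h0 : ∀ i ∈ s, g.eval (a i) ≠ 0
    · rw [poleChar_of_ne_zero ψ w h0, poleChar_of_ne_zero ψ w fun i hi => by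
        rw [hev i hi]; exact h0 i hi, ← AddChar.map_add_eq_mul]
      congr 1
      have hnext : (g + C (-t) * Q).nextCoeff = g.nextCoeff - t := by
        have h1 := (mem_monics.1 (hmem (-t) g hg)).2
        have h2 := (mem_monics.1 hg).2
        rw [nextCoeff_of_natDegree_pos (by omega), nextCoeff_of_natDegree_pos (by omega), h1, h2,
          coeff_add, coeff_C_mul, ← hQd, hQm.coeff_natDegree]
        ring
      rw [logSum, logSum, hnext, Finset.sum_congr rfl fun i hi => by rw [hev i hi, hev' i hi]]
      ring
    · push Not at h0
      obtain ⟨i, hi, h⟩ := h0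
      rw [poleChar_of_eq_zero ψ w hi h, poleChar_of_eq_zero ψ w hi (by rw [hev i hi, h]), mul_zero]
  have hsum : ∑ g ∈ monics k d, poleChar ψ s a w g
      = ∑ g ∈ monics k d, poleChar ψ s a w (g + C (-t) * Q) := by
    symm
    refine Finset.sum_nbij' (fun g => g + C (-t) * Q) (fun g => g + C t * Q)
      (fun g hg => hmem _ g hg) (fun g hg => hmem _ g hg) ?_ ?_ fun g _ => rfl
    · intro g _
      simp
    · intro g _
      simp
  rw [Finset.sum_congr rfl hχ, ← Finset.mul_sum] at hsum
  by_contra h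
  exact ht (mul_right_cancel₀ h (by rw [one_mul]; exact hsum.symm))

theorem natDegree_mul_sum_monics {p : ℕ} [Fact p.Prime] {K : Type*} [Field K] [Algebra (ZMod p) K]
    [CharP K p] [IsAlgClosed K] (χ : (ZMod p)[X] → ℂ)
    (hχ : ∀ f g : (ZMod p)[X], f.Monic → g.Monic → χ (f * g) = χ f * χ g) (d : ℕ) :
    (d : ℂ) * ∑ g ∈ monics (ZMod p) d, χ g =
      ∑ ij ∈ Finset.HasAntidiagonal.antidiagonal d,
        (∑ x ∈ frobFixed p K ij.1, χ (frobDescent p x ij.1)) *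
          ∑ g ∈ monics (ZMod p) ij.2, χ g := by
  classical
  have h1 : (d : ℂ) * ∑ g ∈ monics (ZMod p) d, χ g
      = ∑ g ∈ monics (ZMod p) d, ∑ j ∈ Finset.range (d + 1), ∑ x ∈ frobFixed p K j,
          if frobDescent p x j ∣ g then χ g else 0 := by
    rw [Finset.mul_sum]
    refine Finset.sum_congr rfl fun g hg => ?_
    obtain ⟨hgm, hgd⟩ := mem_monics.1 hg
    conv_lhs => rw [← sum_card_frobDescent_dvd (K := K) hgm hgd]
    rw [Nat.cast_sum, Finset.sum_mul]
    refine Finset.sum_congr rfl fun j _ => ?_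
    rw [← Finset.sum_filter, Finset.sum_const, nsmul_eq_mul]
  rw [h1, Finset.Nat.sum_antidiagonal_eq_sum_range_succ_mk, Finset.sum_comm]
  refine Finset.sum_congr rfl fun j hj => ?_
  have hjd : j ≤ d := by
    rw [Finset.mem_range] at hj
    omega
  rw [Finset.sum_comm]
  simp only
  rw [Finset.sum_mul]
  refine Finset.sum_congr rfl fun x hx => ?_
  have hx' := pow_eq_self_of_mem_frobFixed hx
  have hm := frobDescent_monic hx'
  have hdeg := natDegree_frobDescent hx'
  rw [← Finset.sum_filter, Finset.mul_sum]
  symm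
  refine Finset.sum_bij (fun g _ => frobDescent p x j * g) ?_ ?_ ?_ ?_
  · intro g hg
    obtain ⟨hgm, hgd⟩ := mem_monics.1 hg
    rw [Finset.mem_filter, mem_monics]
    refine ⟨⟨hm.mul hgm, ?_⟩, dvd_mul_right _ _⟩
    rw [hm.natDegree_mul hgm, hdeg, hgd]
    omega
  · intro g _ g' _ h
    exact mul_left_cancel₀ hm.ne_zero h
  · intro g hg
    rw [Finset.mem_filter, mem_monics] at hg
    obtain ⟨⟨hgm, hgd⟩, q, rfl⟩ := hg
    have hq := hm.of_mul_monic_left hgm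
    refine ⟨q, ?_, rfl⟩
    rw [mem_monics]
    refine ⟨hq, ?_⟩
    rw [hm.natDegree_mul hq, hdeg] at hgd
    omega
  · intro g hg
    exact (hχ _ _ hm (mem_monics.1 hg).1).symm

end Monics

section PoleSums

open Polynomial

theorem norm_sum_addChar_le {p : ℕ} [Fact p.Prime] {X : Type*} {ψ : AddChar (ZMod p) ℂ}
    (hψ : ψ ≠ 1) (A : Finset X) (v : X → ZMod p) (B : ℕ)
    (hB : ∀ κ, (A.filter fun x => v x = κ).card ≤ B) :
    ‖∑ x ∈ A, ψ (v x)‖ ≤ p * B - A.card := by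
  have h1 : ∑ x ∈ A, ψ (v x) = -∑ κ : ZMod p,
      (((B : ℝ) - (A.filter fun x => v x = κ).card : ℝ) : ℂ) * ψ κ := by
    have h2 : ∑ κ : ZMod p, (B : ℂ) * ψ κ = 0 := by
      rw [← Finset.mul_sum, AddChar.sum_eq_zero_of_ne_one hψ, mul_zero]
    have h3 : ∑ x ∈ A, ψ (v x)
        = ∑ κ : ZMod p, ((A.filter fun x => v x = κ).card : ℂ) * ψ κ := by
      rw [← Finset.sum_fiberwise A v]
      refine Finset.sum_congr rfl fun κ _ => ?_
      rw [← nsmul_eq_mul, ← Finset.sum_const]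
      refine Finset.sum_congr rfl fun x hx => ?_
      rw [(Finset.mem_filter.1 hx).2]
    push_cast
    simp only [sub_mul, Finset.sum_sub_distrib, h2, zero_sub, neg_neg]
    exact h3
  have h4 : (A.card : ℝ) = ∑ κ : ZMod p, ((A.filter fun x => v x = κ).card : ℝ) := by
    rw [Finset.card_eq_sum_card_fiberwise (f := v) (t := Finset.univ) (fun _ _ => by simp)]
    push_cast
    rfl
  rw [h1, norm_neg]
  calc ‖∑ κ : ZMod p, (((B : ℝ) - (A.filter fun x => v x = κ).card : ℝ) : ℂ) * ψ κ‖
      ≤ ∑ κ : ZMod p, ‖(((B : ℝ) - (A.filter fun x => v x = κ).card : ℝ) : ℂ) * ψ κ‖ :=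
        norm_sum_le _ _
    _ = ∑ κ : ZMod p, ((B : ℝ) - (A.filter fun x => v x = κ).card) := by
        refine Finset.sum_congr rfl fun κ _ => ?_
        rw [norm_mul, AddChar.norm_apply, mul_one, Complex.norm_real, Real.norm_of_nonneg]
        have := hB κ
        rw [sub_nonneg]
        exact_mod_cast this
    _ = p * B - A.card := by
        rw [Finset.sum_sub_distrib, ← h4]
        simp [ZMod.card]

/-- The numerator of `X + ∑ w i / (X - a i)` over the denominator `∏ (X - a i)`. -/
noncomputable def poleNumerator {k ι : Type*} [Field k] (s : Finset ι) (a w : ι → k) : k[X] := by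
  classical exact
  X * ∏ i ∈ s, (X - C (a i)) + ∑ i ∈ s, C (w i) * ∏ j ∈ s.erase i, (X - C (a j))

theorem natDegree_prod_X_sub_C {k ι : Type*} [Field k] (s : Finset ι) (a : ι → k) :
    (∏ i ∈ s, (X - C (a i))).natDegree = s.card := by
  rw [natDegree_prod_of_monic _ _ fun _ _ => monic_X_sub_C _]
  simp only [natDegree_X_sub_C, Finset.sum_const, smul_eq_mul, mul_one]

theorem poleNumerator_spec {k ι : Type*} [Field k] (s : Finset ι) (a w : ι → k) :
    (poleNumerator s a w).Monic ∧ (poleNumerator s a w).natDegree = s.card + 1 := by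
  classical
  set R : k[X] := ∏ i ∈ s, (X - C (a i)) with hR
  have hRm : R.Monic := monic_prod_of_monic _ _ fun _ _ => monic_X_sub_C _
  have hXm : (X * R).Monic := monic_X.mul hRm
  have hXd : (X * R).natDegree = s.card + 1 := by
    rw [monic_X.natDegree_mul hRm, natDegree_X, natDegree_prod_X_sub_C, add_comm]
  have hdeg : (∑ i ∈ s, C (w i) * ∏ j ∈ s.erase i, (X - C (a j))).degree < (X * R).degree := by
    apply degree_lt_degree
    rw [hXd, Nat.lt_succ_iff]
    apply natDegree_sum_le_of_forall_le
    intro i _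
    refine (natDegree_C_mul_le _ _).trans ?_
    rw [natDegree_prod_X_sub_C]
    exact Finset.card_le_card (Finset.erase_subset _ _)
  refine ⟨hXm.add_of_left hdeg, ?_⟩
  rw [← hXd]
  exact natDegree_eq_of_degree_eq (degree_add_eq_left_of_degree_lt hdeg)

theorem aeval_poleNumerator_div {k K ι : Type*} [Field k] [Field K] [Algebra k K] (s : Finset ι)
    (a w : ι → k) {x : K} (hx : ∀ i ∈ s, x ≠ algebraMap k K (a i)) :
    aeval x (poleNumerator s a w) / aeval x (∏ i ∈ s, (X - C (a i)))
      = x + ∑ i ∈ s, algebraMap k K (w i) / (x - algebraMap k K (a i)) := by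
  classical
  have hx' : ∀ i ∈ s, x - algebraMap k K (a i) ≠ 0 := fun i hi => sub_ne_zero.2 (hx i hi)
  have h0 : ∏ i ∈ s, (x - algebraMap k K (a i)) ≠ 0 := Finset.prod_ne_zero_iff.2 hx'
  simp only [poleNumerator, map_add, map_mul, map_sum, map_prod, map_sub, aeval_X, aeval_C]
  rw [div_eq_iff h0, add_mul, Finset.sum_mul]
  congr 1
  refine Finset.sum_congr rfl fun i hi => ?_
  rw [← Finset.prod_erase_mul s _ hi]
  field_simp [hx' i hi]

variable {p : ℕ} [Fact p.Prime] {K : Type*} [Field K] [Algebra (ZMod p) K] [IsAlgClosed K]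
  [CharP K p] {ι : Type*}

theorem pow_card_ne_algebraMap {x : K} {t : ZMod p} (h : x ≠ algebraMap (ZMod p) K t) (m : ℕ) :
    x ^ p ^ m ≠ algebraMap (ZMod p) K t := by
  intro h'
  apply h
  rw [← algebraMap_pow_card_pow t m, ← iterate_frobenius, ← iterate_frobenius] at h'
  exact (frobenius K p).injective.iterate m h'

theorem eval_frobDescent_ne_zero_iff {x : K} {j : ℕ} (hj : j ≠ 0) (hx : x ^ p ^ j = x)
    (t : ZMod p) : (frobDescent p x j).eval t ≠ 0 ↔ x ≠ algebraMap (ZMod p) K t := by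
  rw [← (map_ne_zero_iff _ (algebraMap (ZMod p) K).injective), ← eval_map_apply,
    map_frobDescent hx, frobPoly, eval_prod, Finset.prod_ne_zero_iff]
  simp only [eval_sub, eval_X, eval_C, sub_ne_zero]
  constructor
  · intro h
    have := h 0 (Finset.mem_range.2 (Nat.pos_of_ne_zero hj))
    rw [pow_zero, pow_one] at this
    exact this.symm
  · intro h m _
    exact (pow_card_ne_algebraMap h m).symm

theorem algebraMap_logSum_frobDescent (s : Finset ι) (a w : ι → ZMod p) {x : K} {j : ℕ}
    (hx : x ^ p ^ j = x) (h : ∀ i ∈ s, x ≠ algebraMap (ZMod p) K (a i)) :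
    algebraMap (ZMod p) K (logSum s a w (frobDescent p x j))
      = ∑ m ∈ Finset.range j, (aeval x (poleNumerator s a w) /
          aeval x (∏ i ∈ s, (X - C (a i)))) ^ p ^ m := by
  rw [logSum_map, map_frobDescent hx, frobPoly, logSum_prod _ _ _ (fun m => x ^ p ^ m)]
  · refine Finset.sum_congr rfl fun m _ => ?_
    rw [div_pow, aeval_pow_card_pow, aeval_pow_card_pow, aeval_poleNumerator_div]
    exact fun i hi => pow_card_ne_algebraMap (h i hi) m
  · exact fun i hi m _ => pow_card_ne_algebraMap (h i hi) m

theorem norm_sum_poleChar_frobDescent_le {ψ : AddChar (ZMod p) ℂ} (hψ : ψ ≠ 1) (s : Finset ι)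
    (a w : ι → ZMod p) {μ ν : ℕ} (hμν : μ ≤ ν) (hμ : 2 * (1 + p * s.card) + 5 ≤ p ^ μ) :
    ‖∑ x ∈ frobFixed p K (μ + ν + 2), poleChar ψ s a w (frobDescent p x (μ + ν + 2))‖
      ≤ 7 * (1 + p * s.card) * (p : ℝ) ^ (ν + 2) + s.card := by
  classical
  set j := μ + ν + 2 with hj
  have hj0 : j ≠ 0 := by omega
  set A := (frobFixed p K j).filter fun x => ∀ i ∈ s, x ≠ algebraMap (ZMod p) K (a i) with hA
  set v : K → ZMod p := fun x => logSum s a w (frobDescent p x j) with hv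
  have hsum : ∑ x ∈ frobFixed p K j, poleChar ψ s a w (frobDescent p x j)
      = ∑ x ∈ A, ψ (v x) := by
    rw [hA, Finset.sum_filter]
    refine Finset.sum_congr rfl fun x hx => ?_
    have hx' := pow_eq_self_of_mem_frobFixed hx
    simp only [poleChar, eval_frobDescent_ne_zero_iff hj0 hx', hv]
  have hB : ∀ κ, (A.filter fun x => v x = κ).card
      ≤ p ^ μ * p ^ (ν + 1) + 7 * (1 + p * s.card) * p ^ (ν + 1) := by
    intro κ
    obtain ⟨hPm, hPd⟩ := poleNumerator_spec s a w
    refine stepanov_bound (K := K) (R := ∏ i ∈ s, (X - C (a i))) (P := poleNumerator s a w)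
      (M := s.card) rfl (monic_prod_of_monic _ _ fun _ _ => monic_X_sub_C _) hPm
      (natDegree_prod_X_sub_C s a) hPd hμν hμ κ _ ?_
    intro x hx
    rw [Finset.mem_filter, hA, Finset.mem_filter] at hx
    obtain ⟨⟨hxj, hxa⟩, hxv⟩ := hx
    have hx' := pow_eq_self_of_mem_frobFixed hxj
    have hjj : μ + 1 + (ν + 1) = j := by omega
    rw [hjj]
    refine ⟨hx', ?_, ?_⟩
    · simp only [map_prod, map_sub, aeval_X, aeval_C]
      exact Finset.prod_ne_zero_iff.2 fun i hi => sub_ne_zero.2 (hxa i hi)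
    · rw [← hxv, hv, algebraMap_logSum_frobDescent s a w hx' hxa]
  have hcard : p ^ j ≤ A.card + s.card := by
    rw [← card_frobFixed (K := K) hj0]
    have : frobFixed p K j ⊆ A ∪ s.image fun i => algebraMap (ZMod p) K (a i) := by
      intro x hx
      rw [Finset.mem_union, hA, Finset.mem_filter, Finset.mem_image]
      by_cases h : ∀ i ∈ s, x ≠ algebraMap (ZMod p) K (a i)
      · exact Or.inl ⟨hx, h⟩
      · push Not at h
        obtain ⟨i, hi, h⟩ := h
        exact Or.inr ⟨i, hi, h.symm⟩
    refine (Finset.card_le_card this).trans ((Finset.card_union_le _ _).trans ?_)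
    exact Nat.add_le_add_left Finset.card_image_le _
  rw [hsum]
  refine (norm_sum_addChar_le hψ A v _ hB).trans ?_
  have hcard' : (p : ℝ) ^ j ≤ A.card + s.card := by exact_mod_cast hcard
  have hpj : (p : ℝ) ^ j = p * (p ^ μ * p ^ (ν + 1)) := by
    rw [hj]; ring
  push_cast
  rw [pow_succ (p : ℝ) (ν + 1)]
  nlinarith

theorem exists_norm_sum_poleChar_frobDescent_le {ψ : AddChar (ZMod p) ℂ} (hψ : ψ ≠ 1)
    (s : Finset ι) (a w : ι → ZMod p) :
    ∃ C : ℝ, ∀ j, ‖∑ x ∈ frobFixed p K j, poleChar ψ s a w (frobDescent p x j)‖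
      ≤ C * √p ^ j := by
  classical
  obtain ⟨e, he⟩ : ∃ e, e = 1 + p * s.card := ⟨_, rfl⟩
  obtain ⟨J, hJ⟩ : ∃ J, J = 4 * e + 12 := ⟨_, rfl⟩
  have hpp := (Fact.out : p.Prime)
  have hp1 : (1 : ℝ) ≤ p := by exact_mod_cast hpp.one_le
  have hr1 : 1 ≤ √(p : ℝ) := Real.one_le_sqrt.2 hp1
  have hr2 : √(p : ℝ) ^ 2 = p := Real.sq_sqrt (by positivity)
  refine ⟨(p : ℝ) ^ J + 7 * e * (p : ℝ) ^ 2 + s.card, fun j => ?_⟩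
  have hrj : 1 ≤ √(p : ℝ) ^ j := one_le_pow₀ hr1
  rcases lt_or_ge j J with hjJ | hjJ
  · have h1 : ‖∑ x ∈ frobFixed p K j, poleChar ψ s a w (frobDescent p x j)‖
        ≤ (frobFixed p K j).card := by
      refine (norm_sum_le_of_le _ (fun x _ => ?_)).trans (b := ∑ x ∈ frobFixed p K j, (1 : ℝ)) ?_
      · unfold poleChar
        split_ifs
        · rw [AddChar.norm_apply]
        · simp
      · simp
    have h2 : ((frobFixed p K j).card : ℝ) ≤ (p : ℝ) ^ J := by
      rcases eq_or_ne j 0 with rfl | hj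
      · simp only [frobFixed_zero, Finset.card_empty, Nat.cast_zero]
        positivity
      · rw [card_frobFixed hj]
        push_cast
        exact pow_le_pow_right₀ hp1 hjJ.le
    have h3 : 0 ≤ 7 * (e : ℝ) * (p : ℝ) ^ 2 + s.card := by positivity
    have h4 : 0 ≤ (p : ℝ) ^ J := by positivity
    nlinarith
  · obtain ⟨μ, hμ⟩ : ∃ μ, μ = j / 2 - 1 := ⟨_, rfl⟩
    obtain ⟨ν, hν⟩ : ∃ ν, ν = j - 2 - μ := ⟨_, rfl⟩
    have hj : j = μ + ν + 2 := by omega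
    have hμe : 2 * e + 5 ≤ p ^ μ := by
      have h1 : μ < p ^ μ := Nat.lt_pow_self hpp.one_lt
      omega
    have hmain := norm_sum_poleChar_frobDescent_le (K := K) hψ s a w (μ := μ)
      (ν := ν) (by omega) (by rw [← he]; exact hμe)
    rw [← hj] at hmain
    refine hmain.trans ?_
    have hpow : (p : ℝ) ^ (ν + 2) ≤ p ^ 2 * √(p : ℝ) ^ j := by
      rw [← hr2, ← pow_mul, ← pow_mul, hr2, ← pow_add]
      exact pow_le_pow_right₀ hr1 (by omega)
    have he' : (1 + (p : ℝ) * s.card) = e := by rw [he]; push_cast; ring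
    rw [he']
    have h5 : 7 * (e : ℝ) * (p : ℝ) ^ (ν + 2) ≤ 7 * (e : ℝ) * (p ^ 2 * √(p : ℝ) ^ j) :=
      mul_le_mul_of_nonneg_left hpow
        (mul_nonneg (by norm_num) (Nat.cast_nonneg e))
    have h6 : (s.card : ℝ) ≤ s.card * √(p : ℝ) ^ j := le_mul_of_one_le_right (Nat.cast_nonneg _) hrj
    have h7 : 0 ≤ (p : ℝ) ^ J * √(p : ℝ) ^ j := by positivity
    nlinarith

end PoleSums

open Polynomial in
/-- Weil's bound for sums over a prime field of a rational function with simple poles at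
finite points and at infinity. -/
theorem norm_sum_addChar_simple_poles_le {p : ℕ} [Fact p.Prime] {ι : Type*}
    {ψ : AddChar (ZMod p) ℂ} (hψ : ψ ≠ 1) (s : Finset ι) (a w : ι → ZMod p)
    [DecidablePred fun x => ∀ i ∈ s, x ≠ a i] :
    ‖∑ x : ZMod p with ∀ i ∈ s, x ≠ a i, ψ (x + ∑ i ∈ s, w i / (x - a i))‖
      ≤ 2 * s.card * √p := by
  have : CharP (AlgebraicClosure (ZMod p)) p := inferInstance
  obtain ⟨C, hC⟩ := exists_norm_sum_poleChar_frobDescent_le (K := AlgebraicClosure (ZMod p)) hψ s a w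
  have hr : 0 < √(p : ℝ) := Real.sqrt_pos.2 (by exact_mod_cast (Fact.out : p.Prime).pos)
  have h := norm_coeff_one_le_of_newton
    (c := fun d => ∑ g ∈ monics (ZMod p) d, poleChar ψ s a w g) (D := 2 * s.card) hr
    (by simp only [sum_monics_zero, poleChar_one])
    (fun d hd => sum_monics_poleChar_eq_zero hψ s a w hd) hC
    (natDegree_mul_sum_monics _ fun f g hf hg => poleChar_mul ψ s a w hf hg)
  simp only [sum_monics_one] at h
  rw [Finset.sum_filter]
  push_cast at h
  refine le_trans (le_of_eq ?_) h
  congr 1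
  refine Finset.sum_congr rfl fun x _ => ?_
  have hiff : (∀ i ∈ s, x ≠ a i) ↔ ∀ i ∈ s, (Polynomial.X - Polynomial.C x).eval (a i) ≠ 0 := by
    simp only [eval_sub, eval_X, eval_C, sub_ne_zero]
    exact forall₂_congr fun _ _ => ne_comm
  by_cases hx : ∀ i ∈ s, x ≠ a i
  · rw [if_pos hx, poleChar_of_ne_zero ψ w (hiff.1 hx), logSum_X_sub_C]
  · rw [if_neg hx]
    unfold poleChar
    rw [if_neg fun H => hx (hiff.2 H)]

theorem mobius_inv_eq {k : Type*} [Field k] {c d y : k} (hd : d ≠ 0) (hy : y ≠ 0)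
    (hyd : y ≠ -c / d) :
    (c * y⁻¹ + d)⁻¹ = d⁻¹ + (-c / d ^ 2) / (y - -c / d) := by
  have h1 : y - -c / d ≠ 0 := sub_ne_zero.2 hyd
  have h2 : c + d * y ≠ 0 := by
    intro h
    apply h1
    field_simp
    linear_combination h
  have h3 : y - -c / d = (c + d * y) / d := by
    field_simp
    ring
  have h4 : c * y⁻¹ + d = (c + d * y) / y := by
    field_simp
  rw [h3, h4]
  field_simp
  ring

theorem norm_sum_addChar_inverses_le {p : ℕ} [Fact p.Prime] {ι : Type*}
    {ψ : AddChar (ZMod p) ℂ} (hψ : ψ ≠ 1) (T : Finset ι) (h o : ι → ZMod p)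
    (hT : T.Nonempty) (hh : ∀ i ∈ T, h i ≠ 0) (ho : Set.InjOn o T) :
    ‖∑ x : ZMod p, ψ (∑ i ∈ T, h i * (x + o i)⁻¹)‖
      ≤ 2 * ((T.card : ℝ) - 1) * √p + 1 + T.card := by
  classical
  obtain ⟨i₀, hi₀⟩ := hT
  set c := h i₀ with hc
  have hc0 : c ≠ 0 := hh i₀ hi₀
  set s := T.erase i₀ with hs
  have hcard : (s.card : ℝ) = T.card - 1 := by
    rw [hs, Finset.card_erase_of_mem hi₀, Nat.cast_sub (Finset.card_pos.2 ⟨i₀, hi₀⟩), Nat.cast_one]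
  set d : ι → ZMod p := fun i => o i - o i₀ with hd
  have hd0 : ∀ i ∈ s, d i ≠ 0 := by
    intro i hi
    obtain ⟨h1, h2⟩ := Finset.mem_erase.1 hi
    exact sub_ne_zero.2 fun h => h1 (ho h2 hi₀ h)
  set a : ι → ZMod p := fun i => -c / d i with ha
  set w : ι → ZMod p := fun i => h i * (-c / d i ^ 2) with hw
  set κ : ZMod p := ∑ i ∈ s, h i * (d i)⁻¹ with hκ
  set G : ZMod p → ℂ := fun y => ψ κ * ψ (y + ∑ i ∈ s, w i / (y - a i)) with hG
  set B : ZMod p → ℂ := fun y => ψ (∑ i ∈ T, h i * (c * y⁻¹ - o i₀ + o i)⁻¹) with hB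
  have hBG : ∀ y, (∀ i ∈ s, y ≠ a i) → y ≠ 0 → B y = G y := by
    intro y hy hy0
    simp only [hB, hG]
    rw [← AddChar.map_add_eq_mul, ← Finset.add_sum_erase T _ hi₀]
    congr 1
    have h1 : ∀ i ∈ s, h i * (c * y⁻¹ - o i₀ + o i)⁻¹ = h i * (d i)⁻¹ + w i / (y - a i) := by
      intro i hi
      have : c * y⁻¹ - o i₀ + o i = c * y⁻¹ + d i := by simp only [hd]; ring
      rw [this, mobius_inv_eq (hd0 i hi) hy0 (hy i hi), mul_add, mul_div_assoc]
    rw [Finset.sum_congr rfl h1, Finset.sum_add_distrib, ← hκ, sub_add_cancel, mul_inv, inv_inv,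
      ← hc, mul_inv_cancel_left₀ hc0]
    ring
  have hBn : ∀ y, ‖B y‖ = 1 := fun y => AddChar.norm_apply _ _
  have hGn : ∀ y, ‖G y‖ = 1 := fun y => by
    simp only [hG, norm_mul, AddChar.norm_apply, mul_one]
  have hsubst : ∑ x : ZMod p, ψ (∑ i ∈ T, h i * (x + o i)⁻¹) = ∑ y, B y := by
    symm
    refine Function.Bijective.sum_comp (e := fun y : ZMod p => c * y⁻¹ - o i₀) ?_
      (fun x => ψ (∑ i ∈ T, h i * (x + o i)⁻¹))
    refine Finite.injective_iff_bijective.1 fun y z hyz => ?_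
    have := sub_left_injective hyz
    exact inv_injective (mul_left_cancel₀ hc0 this)
  have hweil := norm_sum_addChar_simple_poles_le hψ s a w
  have hGsum : ‖∑ y : ZMod p with ∀ i ∈ s, y ≠ a i, G y‖ ≤ 2 * ((T.card : ℝ) - 1) * √p := by
    simp only [hG]
    rw [← Finset.mul_sum, norm_mul, AddChar.norm_apply, one_mul, ← hcard]
    exact hweil
  have hdiff : ‖∑ y : ZMod p with ∀ i ∈ s, y ≠ a i, (B y - G y)‖ ≤ 2 := by
    refine (norm_sum_le_of_le _ (f := fun y => B y - G y)
      (n := fun y => if y = 0 then (2 : ℝ) else 0) ?_).trans ?_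
    · intro y hy
      rw [Finset.mem_filter] at hy
      split_ifs with h0
      · refine (norm_sub_le _ _).trans ?_
        rw [hBn, hGn]
        norm_num
      · rw [hBG y hy.2 h0, sub_self, norm_zero]
    · rw [Finset.sum_ite_eq']
      split_ifs <;> norm_num
  have hbad : ‖∑ y : ZMod p with ¬ ∀ i ∈ s, y ≠ a i, B y‖ ≤ (T.card : ℝ) - 1 := by
    refine (norm_sum_le_of_le _ fun y _ => (hBn y).le).trans ?_
    rw [Finset.sum_const, nsmul_eq_mul, mul_one, ← hcard]
    have : (Finset.univ.filter fun y : ZMod p => ¬ ∀ i ∈ s, y ≠ a i) ⊆ s.image a := by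
      intro y hy
      rw [Finset.mem_filter] at hy
      have h := hy.2
      push Not at h
      obtain ⟨i, hi, h⟩ := h
      exact Finset.mem_image.2 ⟨i, hi, h.symm⟩
    exact_mod_cast (Finset.card_le_card this).trans Finset.card_image_le
  rw [hsubst, ← Finset.sum_filter_add_sum_filter_not Finset.univ (fun y => ∀ i ∈ s, y ≠ a i) B]
  have hsplit : ∑ y : ZMod p with ∀ i ∈ s, y ≠ a i, B y
      = ∑ y : ZMod p with ∀ i ∈ s, y ≠ a i, (B y - G y)
        + ∑ y : ZMod p with ∀ i ∈ s, y ≠ a i, G y := by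
    rw [← Finset.sum_add_distrib]
    simp only [sub_add_cancel]
  rw [hsplit]
  refine (norm_add_le _ _).trans ?_
  have := norm_add_le (∑ y : ZMod p with ∀ i ∈ s, y ≠ a i, (B y - G y))
    (∑ y : ZMod p with ∀ i ∈ s, y ≠ a i, G y)
  linarith

theorem two_mul_le_log_one_add_sub_log_one_sub {x : ℝ} (h0 : 0 ≤ x) (h1 : x < 1) :
    2 * x ≤ Real.log (1 + x) - Real.log (1 - x) := by
  have h := Real.hasSum_log_sub_log_of_abs_lt_one (x := x) (by rw [abs_of_nonneg h0]; exact h1)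
  have := le_hasSum h 0 fun j _ => by positivity
  simpa using this

theorem sin_div_sin_le_log_tan {θ δ : ℝ} (hδ : 0 < δ) (hδθ : δ < θ) (hθ : θ + δ < Real.pi) :
    2 * Real.sin δ / Real.sin θ
      ≤ Real.log (Real.tan ((θ + δ) / 2)) - Real.log (Real.tan ((θ - δ) / 2)) := by
  have hA : Real.sin θ + Real.sin δ = 2 * (Real.sin ((θ + δ) / 2) * Real.cos ((θ - δ) / 2)) := by
    rw [Real.sin_add_sin]; ring
  have hB : Real.sin θ - Real.sin δ = 2 * (Real.sin ((θ - δ) / 2) * Real.cos ((θ + δ) / 2)) := by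
    rw [Real.sin_sub_sin]; ring
  have h1 : 0 < Real.sin ((θ + δ) / 2) := Real.sin_pos_of_pos_of_lt_pi (by linarith) (by linarith)
  have h2 : 0 < Real.sin ((θ - δ) / 2) := Real.sin_pos_of_pos_of_lt_pi (by linarith) (by linarith)
  have h3 : 0 < Real.cos ((θ + δ) / 2) := Real.cos_pos_of_mem_Ioo ⟨by linarith, by linarith⟩
  have h4 : 0 < Real.cos ((θ - δ) / 2) := Real.cos_pos_of_mem_Ioo ⟨by linarith, by linarith⟩
  have h5 : 0 < Real.sin θ := Real.sin_pos_of_pos_of_lt_pi (by linarith) (by linarith)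
  have h6 : 0 < Real.sin δ := Real.sin_pos_of_pos_of_lt_pi hδ (by linarith)
  have h7 : 0 < Real.sin θ - Real.sin δ := by rw [hB]; positivity
  have hx : Real.sin δ / Real.sin θ < 1 := by rw [div_lt_one h5]; linarith
  have hlog := two_mul_le_log_one_add_sub_log_one_sub (div_nonneg h6.le h5.le) hx
  rw [mul_div_assoc]
  refine hlog.trans (le_of_eq ?_)
  have hx0 := div_pos h6 h5
  rw [← Real.log_div (by linarith) (by linarith), ← Real.log_div, Real.tan_eq_sin_div_cos,
    Real.tan_eq_sin_div_cos]
  · congr 1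
    have e1 : 1 + Real.sin δ / Real.sin θ
        = 2 * (Real.sin ((θ + δ) / 2) * Real.cos ((θ - δ) / 2)) / Real.sin θ := by
      rw [← hA]; field_simp
    have e2 : 1 - Real.sin δ / Real.sin θ
        = 2 * (Real.sin ((θ - δ) / 2) * Real.cos ((θ + δ) / 2)) / Real.sin θ := by
      rw [← hB]; field_simp
    rw [e1, e2]
    field_simp
  · rw [Real.tan_eq_sin_div_cos]; positivity
  · rw [Real.tan_eq_sin_div_cos]; positivity

theorem sum_inv_sin_mul_sin_le {p : ℕ} (hp : 2 ≤ p) :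
    (∑ h ∈ Finset.Ico 1 p, (Real.sin (Real.pi * h / p))⁻¹) * Real.sin (Real.pi / (2 * p))
      ≤ Real.log (4 * p / Real.pi) := by
  have hp0 : (0 : ℝ) < p := by exact_mod_cast (by omega : 0 < p)
  have hp2 : (2 : ℝ) ≤ p := by exact_mod_cast hp
  have hpi := Real.pi_pos
  set δ : ℝ := Real.pi / (2 * p) with hδ
  have hδ0 : 0 < δ := by positivity
  have hpδ : (p : ℝ) * δ = Real.pi / 2 := by rw [hδ]; field_simp
  set G : ℕ → ℝ := fun h => Real.log (Real.tan ((2 * h - 1) * δ / 2)) with hG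
  have hterm : ∀ h ∈ Finset.Ico 1 p, 2 * ((Real.sin (Real.pi * h / p))⁻¹ * Real.sin δ)
      ≤ G (h + 1) - G h := by
    intro h hh
    rw [Finset.mem_Ico] at hh
    have h1 : (1 : ℝ) ≤ h := by exact_mod_cast hh.1
    have h2 : (h : ℝ) + 1 ≤ p := by exact_mod_cast hh.2
    have hθ : Real.pi * h / p = 2 * h * δ := by rw [hδ]; field_simp
    have := sin_div_sin_le_log_tan (θ := 2 * h * δ) (δ := δ) hδ0 (by nlinarith) (by nlinarith)
    rw [hθ, hG]
    simp only
    have e1 : (2 * ((h + 1 : ℕ) : ℝ) - 1) * δ / 2 = (2 * h * δ + δ) / 2 := by push_cast; ring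
    have e2 : (2 * (h : ℝ) - 1) * δ / 2 = (2 * h * δ - δ) / 2 := by ring
    rw [e1, e2]
    refine le_trans (le_of_eq ?_) this
    ring
  have hsum := Finset.sum_le_sum hterm
  rw [Finset.sum_Ico_sub G (by omega), ← Finset.mul_sum, ← Finset.sum_mul] at hsum
  have hGp : G p = -G 1 := by
    simp only [hG]
    have e1 : (2 * (p : ℝ) - 1) * δ / 2 = Real.pi / 2 - (2 * ((1 : ℕ) : ℝ) - 1) * δ / 2 := by
      push_cast; linarith
    rw [e1, Real.tan_pi_div_two_sub, Real.log_inv]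
  have hG1 : -G 1 ≤ Real.log (4 * p / Real.pi) := by
    simp only [hG]
    rw [← Real.log_inv]
    have hδ2 : δ / 2 < Real.pi / 2 := by nlinarith
    have ht : δ / 2 < Real.tan (δ / 2) := Real.lt_tan (by positivity) hδ2
    have e1 : (2 * ((1 : ℕ) : ℝ) - 1) * δ / 2 = δ / 2 := by push_cast; ring
    have e2 : 4 * p / Real.pi = (δ / 2)⁻¹ := by rw [hδ]; field_simp; norm_num
    rw [e1, e2]
    apply Real.log_le_log
    · exact inv_pos.2 ((by positivity : 0 < δ / 2).trans ht)
    · exact inv_anti₀ (by positivity) ht.le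
  linarith

theorem sum_inv_sin_le {p : ℕ} (hp : 2 ≤ p) :
    ∑ h ∈ Finset.Ico 1 p, (p * Real.sin (Real.pi * h / p))⁻¹
      ≤ 2 / Real.pi * Real.log p + 2 / 5 := by
  have hp2 : (2 : ℝ) ≤ p := by exact_mod_cast hp
  have hp0 : (0 : ℝ) < p := by linarith
  have hpi := Real.pi_pos
  have hpi3 := Real.pi_gt_d2
  have hpi4 := Real.pi_lt_d2
  have hmain := sum_inv_sin_mul_sin_le hp
  set A := ∑ h ∈ Finset.Ico 1 p, (Real.sin (Real.pi * h / p))⁻¹ with hA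
  have hA0 : 0 ≤ A := by
    refine Finset.sum_nonneg fun h hh => ?_
    rw [Finset.mem_Ico] at hh
    have h2 : (h : ℝ) ≤ p := by exact_mod_cast hh.2.le
    refine inv_nonneg.2 (Real.sin_nonneg_of_nonneg_of_le_pi (by positivity) ?_)
    rw [div_le_iff₀ hp0]
    exact mul_le_mul_of_nonneg_left h2 hpi.le
  have hL : ∑ h ∈ Finset.Ico 1 p, (p * Real.sin (Real.pi * h / p))⁻¹ = A / p := by
    rw [hA, Finset.sum_div]
    refine Finset.sum_congr rfl fun h _ => ?_
    rw [mul_inv]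
    ring
  rw [hL]
  set δ : ℝ := Real.pi / (2 * p) with hδ
  have hpδ : (p : ℝ) * δ = Real.pi / 2 := by rw [hδ]; field_simp
  have hδ0 : 0 < δ := by positivity
  have hδ1 : δ ≤ 1 := by
    rw [hδ, div_le_one (by positivity)]
    linarith
  have hsin := Real.sin_gt_sub_cube hδ0
  have hlog4 : Real.log (4 * p / Real.pi) ≤ Real.log p + (274 / 1000 : ℝ) := by
    have e : 4 * p / Real.pi = p * (4 / Real.pi) := by ring
    rw [e, Real.log_mul hp0.ne' (by positivity)]
    have h1 := Real.log_le_sub_one_of_pos (x := 4 / Real.pi) (by positivity)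
    have h2 : 4 / Real.pi ≤ 1274 / 1000 := by
      rw [div_le_iff₀ hpi]
      linarith
    linarith
  have hlogp : Real.log p ≤ p - 1 := Real.log_le_sub_one_of_pos hp0
  have hlogp0 : 0 ≤ Real.log p := Real.log_nonneg (by linarith)
  have hsq : p * δ ^ 2 / 4 * p ≤ 0.625 := by
    have : p * δ ^ 2 / 4 * p = (p * δ) ^ 2 / 4 := by ring
    rw [this, hpδ]
    nlinarith
  have hη : δ ^ 2 / 4 * (Real.log p + 63 / 100) ≤ 3125 / 10000 := by
    have h1 : δ ^ 2 / 4 * (Real.log p + 63 / 100) ≤ δ ^ 2 / 4 * p :=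
      mul_le_mul_of_nonneg_left (by linarith) (by positivity)
    have h2 : 0 ≤ δ ^ 2 / 4 * p := by positivity
    nlinarith
  have hkey : A * (δ - δ ^ 3 / 4) ≤ (Real.log p + Real.pi / 5) * (1 - δ ^ 2 / 4) := by
    have h1 : A * (δ - δ ^ 3 / 4) ≤ A * Real.sin δ := by
      have : 0 < δ ^ 3 := by positivity
      exact mul_le_mul_of_nonneg_left (by linarith) hA0
    have h2 : δ ^ 2 / 4 * (Real.log p + Real.pi / 5) ≤ δ ^ 2 / 4 * (Real.log p + 63 / 100) :=
      mul_le_mul_of_nonneg_left (by linarith) (by positivity)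
    nlinarith
  have h1 : 0 < 1 - δ ^ 2 / 4 := by nlinarith
  have h2 : A * δ ≤ Real.log p + Real.pi / 5 := by
    refine le_of_mul_le_mul_right ?_ h1
    calc A * δ * (1 - δ ^ 2 / 4) = A * (δ - δ ^ 3 / 4) := by ring
      _ ≤ _ := hkey
  have h3 : A / p = A * δ * (2 / Real.pi) := by
    rw [hδ]
    field_simp
  rw [h3]
  calc A * δ * (2 / Real.pi) ≤ (Real.log p + Real.pi / 5) * (2 / Real.pi) :=
        mul_le_mul_of_nonneg_right h2 (by positivity)
    _ = _ := by
        field_simp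

theorem norm_sum_Ico_stdAddChar_le {p : ℕ} [Fact p.Prime] {h : ZMod p} (hh : h ≠ 0) {A B : ℕ}
    (hAB : A ≤ B) :
    ‖∑ m ∈ Finset.Ico A B, (ZMod.stdAddChar (h * (m : ZMod p)) : ℂ)‖
      ≤ (Real.sin (Real.pi * h.val / p))⁻¹ := by
  have hp0 : (0 : ℝ) < p := by exact_mod_cast (Fact.out : p.Prime).pos
  have hv0 : (0 : ℝ) < h.val := by
    exact_mod_cast Nat.pos_of_ne_zero ((ZMod.val_ne_zero h).2 hh)
  have hvp : (h.val : ℝ) < p := by exact_mod_cast ZMod.val_lt h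
  have hsin : 0 < Real.sin (Real.pi * h.val / p) := by
    apply Real.sin_pos_of_pos_of_lt_pi
    · have := Real.pi_pos
      positivity
    · rw [div_lt_iff₀ hp0]
      exact mul_lt_mul_of_pos_left hvp Real.pi_pos
  have hgeom : ∑ m ∈ Finset.Ico A B, (ZMod.stdAddChar (h * (m : ZMod p)) : ℂ)
      = ∑ m ∈ Finset.Ico A B, (ZMod.stdAddChar h : ℂ) ^ m := by
    refine Finset.sum_congr rfl fun m _ => ?_
    rw [← AddChar.map_nsmul_eq_pow, nsmul_eq_mul, mul_comm]
  have hz : (ZMod.stdAddChar h : ℂ)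
      = Complex.exp (Complex.I * ((2 * (Real.pi * h.val / p) : ℝ) : ℂ)) := by
    have h1 := ZMod.stdAddChar_coe (N := p) (h.val : ℤ)
    rw [Int.cast_natCast, ZMod.natCast_zmod_val] at h1
    rw [h1]
    congr 1
    push_cast
    ring
  have hnorm : ‖(ZMod.stdAddChar h : ℂ) - 1‖ = 2 * Real.sin (Real.pi * h.val / p) := by
    rw [hz, Complex.norm_exp_I_mul_ofReal_sub_one, mul_div_cancel_left₀ _ (two_ne_zero' ℝ),
      Real.norm_of_nonneg (by positivity)]
  have hmul := geom_sum_Ico_mul (ZMod.stdAddChar h : ℂ) hAB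
  rw [hgeom, ← one_div, le_div_iff₀ hsin]
  have h2 : ‖∑ m ∈ Finset.Ico A B, (ZMod.stdAddChar h : ℂ) ^ m‖
      * (2 * Real.sin (Real.pi * h.val / p)) ≤ 2 := by
    rw [← hnorm, ← norm_mul, hmul]
    refine (norm_sub_le _ _).trans ?_
    rw [norm_pow, norm_pow, AddChar.norm_apply, one_pow, one_pow]
    norm_num
  linarith

theorem map_sum_addChar {A ι : Type*} [AddCommMonoid A] (ψ : AddChar A ℂ) (s : Finset ι)
    (f : ι → A) : ψ (∑ i ∈ s, f i) = ∏ i ∈ s, ψ (f i) := by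
  classical
  induction s using Finset.induction_on with
  | empty => simp
  | insert i s hi ih => rw [Finset.sum_insert hi, Finset.prod_insert hi, AddChar.map_add_eq_mul, ih]

theorem indicator_eq_sum_addChar {p : ℕ} [Fact p.Prime] {ψ : AddChar (ZMod p) ℂ}
    (hψ : ψ.IsPrimitive) (I : Finset (ZMod p)) (y : ZMod p) :
    (if y ∈ I then (1 : ℂ) else 0)
      = ∑ h : ZMod p, (p : ℂ)⁻¹ * (∑ z ∈ I, ψ (h * z)) * ψ⁻¹ (h * y) := by
  have hp : (p : ℂ) ≠ 0 := by exact_mod_cast (Fact.out : p.Prime).ne_zero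
  have h1 : ∀ z, ∑ h : ZMod p, ψ (h * z) * ψ⁻¹ (h * y) = if z = y then (p : ℂ) else 0 := by
    intro z
    have := AddChar.sum_mulShift (z - y) hψ
    rw [ZMod.card] at this
    simp only [sub_eq_zero] at this
    rw [show (if z = y then (p : ℂ) else 0) = ((if z = y then p else 0 : ℕ) : ℂ) by
      split_ifs <;> simp, ← this]
    refine Finset.sum_congr rfl fun h _ => ?_
    rw [AddChar.inv_apply, ← AddChar.map_add_eq_mul]
    congr 1
    ring
  simp only [Finset.sum_mul, Finset.mul_sum, mul_assoc]
  rw [Finset.sum_comm]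
  simp only [← Finset.mul_sum, h1]
  rw [Finset.sum_ite_eq']
  split_ifs
  · rw [inv_mul_cancel₀ hp]
  · rw [mul_zero]

theorem abs_card_sub_prod_le {p : ℕ} [Fact p.Prime] {X κ : Type*} [Fintype X] [Fintype κ]
    [DecidableEq κ] (hX : Fintype.card X = p) {ψ : AddChar (ZMod p) ℂ} (hψ : ψ.IsPrimitive)
    (v : X → κ → ZMod p) (I : κ → Finset (ZMod p)) (ρ : ZMod p → ℝ)
    (hρ : ∀ i h, ‖(p : ℂ)⁻¹ * ∑ z ∈ I i, ψ (h * z)‖ ≤ ρ h)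
    (f : (κ → ZMod p) → ℝ) (hf : ∀ h ≠ 0, ‖∑ x, ψ⁻¹ (∑ i, h i * v x i)‖ ≤ f h) :
    |((Finset.univ.filter fun x => ∀ i, v x i ∈ I i).card : ℝ) / p
        - ∏ i, ((I i).card : ℝ) / p|
      ≤ (p : ℝ)⁻¹ * ∑ h ∈ Finset.univ.erase 0, (∏ i, ρ (h i)) * f h := by
  classical
  have hp : (p : ℂ) ≠ 0 := by exact_mod_cast (Fact.out : p.Prime).ne_zero
  set c : κ → ZMod p → ℂ := fun i h => (p : ℂ)⁻¹ * ∑ z ∈ I i, ψ (h * z) with hc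
  have hcount : ((Finset.univ.filter fun x => ∀ i, v x i ∈ I i).card : ℂ)
      = ∑ h : κ → ZMod p, (∏ i, c i (h i)) * ∑ x, ψ⁻¹ (∑ i, h i * v x i) := by
    have h1 : ((Finset.univ.filter fun x => ∀ i, v x i ∈ I i).card : ℂ)
        = ∑ x, ∏ i, if v x i ∈ I i then (1 : ℂ) else 0 := by
      rw [Finset.card_filter]
      push_cast
      refine Finset.sum_congr rfl fun x _ => ?_
      rw [Finset.prod_ite_zero]
      simp
    rw [h1]
    simp only [indicator_eq_sum_addChar hψ, Finset.prod_univ_sum, Fintype.piFinset_univ,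
      Finset.mul_sum]
    rw [Finset.sum_comm]
    refine Finset.sum_congr rfl fun h _ => Finset.sum_congr rfl fun x _ => ?_
    rw [Finset.prod_mul_distrib]
    congr 1
    · exact Finset.prod_congr rfl fun i _ => (Finset.mul_sum _ _ _).symm
    · rw [map_sum_addChar]
  have hzero : (∏ i, c i ((0 : κ → ZMod p) i)) * ∑ x, ψ⁻¹ (∑ i, (0 : κ → ZMod p) i * v x i)
      = p * ∏ i, ((I i).card : ℂ) / p := by
    simp only [hc, Pi.zero_apply, zero_mul, AddChar.map_zero_eq_one, Finset.sum_const_zero,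
      Finset.sum_const, nsmul_eq_mul, mul_one, Finset.card_univ, hX]
    rw [mul_comm]
    congr 1
    refine Finset.prod_congr rfl fun i _ => ?_
    rw [div_eq_inv_mul]
  rw [← Finset.add_sum_erase _ _ (Finset.mem_univ (0 : κ → ZMod p)), hzero] at hcount
  have hdiff : (((((Finset.univ.filter fun x => ∀ i, v x i ∈ I i).card : ℝ) / p
      - ∏ i, ((I i).card : ℝ) / p : ℝ)) : ℂ)
      = (p : ℂ)⁻¹ * ∑ h ∈ Finset.univ.erase (0 : κ → ZMod p),
          (∏ i, c i (h i)) * ∑ x, ψ⁻¹ (∑ i, h i * v x i) := by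
    push_cast
    rw [hcount]
    field_simp
    ring
  rw [← Real.norm_eq_abs, ← Complex.norm_real, hdiff, norm_mul, norm_inv, Complex.norm_natCast]
  refine mul_le_mul_of_nonneg_left ?_ (by positivity)
  refine norm_sum_le_of_le _ fun h hh => ?_
  have hh0 : h ≠ 0 := (Finset.mem_erase.1 hh).1
  rw [norm_mul, norm_prod]
  refine mul_le_mul ?_ (hf h hh0) (norm_nonneg _) ?_
  · exact Finset.prod_le_prod (fun i _ => norm_nonneg _) fun i _ => hρ i _
  · exact Finset.prod_nonneg fun i _ => (norm_nonneg _).trans (hρ i _)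

theorem sum_prod_mul_support_card {G κ : Type*} [Fintype G] [Fintype κ] [DecidableEq κ]
    [Zero G] [DecidableEq G] (ρ : G → ℝ) :
    ∑ h : κ → G, (∏ i, ρ (h i)) * ((Finset.univ.filter fun i => h i ≠ 0).card : ℝ)
      = Fintype.card κ * (∑ g ∈ Finset.univ.erase 0, ρ g) * (∑ g, ρ g) ^ (Fintype.card κ - 1) := by
  have h1 : ∀ h : κ → G, (∏ i, ρ (h i)) * ((Finset.univ.filter fun i => h i ≠ 0).card : ℝ)
      = ∑ j, ∏ i, if i = j then (if h i ≠ 0 then ρ (h i) else 0) else ρ (h i) := by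
    intro h
    rw [Finset.card_filter]
    push_cast
    rw [Finset.mul_sum]
    refine Finset.sum_congr rfl fun j _ => ?_
    rw [← Finset.mul_prod_erase _ _ (Finset.mem_univ j),
      ← Finset.mul_prod_erase Finset.univ (fun i => if i = j then _ else _) (Finset.mem_univ j),
      Finset.prod_congr rfl fun i hi => if_neg (Finset.ne_of_mem_erase hi)]
    simp only [if_true]
    split_ifs <;> ring
  simp only [h1]
  rw [Finset.sum_comm]
  have h2 : ∀ j : κ, ∑ h : κ → G, ∏ i, (if i = j then (if h i ≠ 0 then ρ (h i) else 0) else ρ (h i))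
      = (∑ g ∈ Finset.univ.erase 0, ρ g) * (∑ g, ρ g) ^ (Fintype.card κ - 1) := by
    intro j
    have h3 := Finset.prod_univ_sum (fun _ : κ => (Finset.univ : Finset G))
      (fun i g => if i = j then (if g ≠ 0 then ρ g else 0) else ρ g)
    rw [Fintype.piFinset_univ] at h3
    rw [← h3, ← Finset.mul_prod_erase _ _ (Finset.mem_univ j)]
    congr 1
    · simp only [if_true]
      rw [← Finset.sum_filter]
      congr 1
      ext g
      simp
    · rw [Finset.prod_congr rfl (g := fun _ => ∑ g, ρ g) fun i hi => by
        simp only [if_neg (Finset.ne_of_mem_erase hi)], Finset.prod_const,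
        Finset.card_erase_of_mem (Finset.mem_univ j), Finset.card_univ]
  simp only [h2, Finset.sum_const, nsmul_eq_mul, Finset.card_univ]
  ring

theorem abs_prod_sub_prod_le_sum {ι : Type*} (s : Finset ι) (x y : ι → ℝ)
    (hx : ∀ i ∈ s, |x i| ≤ 1) (hy : ∀ i ∈ s, |y i| ≤ 1) :
    |∏ i ∈ s, x i - ∏ i ∈ s, y i| ≤ ∑ i ∈ s, |x i - y i| := by
  classical
  induction s using Finset.induction_on with
  | empty => simp
  | insert i s hi ih =>
    rw [Finset.prod_insert hi, Finset.prod_insert hi, Finset.sum_insert hi]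
    have h1 := ih (fun j hj => hx j (Finset.mem_insert_of_mem hj))
      (fun j hj => hy j (Finset.mem_insert_of_mem hj))
    have h2 : |∏ j ∈ s, y j| ≤ 1 := by
      rw [Finset.abs_prod]
      exact Finset.prod_le_one (fun _ _ => abs_nonneg _)
        fun j hj => hy j (Finset.mem_insert_of_mem hj)
    have h3 := hx i (Finset.mem_insert_self i s)
    have e : x i * ∏ j ∈ s, x j - y i * ∏ j ∈ s, y j
        = x i * (∏ j ∈ s, x j - ∏ j ∈ s, y j) + (x i - y i) * ∏ j ∈ s, y j := by ring
    rw [e]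
    refine (abs_add_le _ _).trans ?_
    rw [abs_mul, abs_mul, add_comm]
    refine add_le_add (mul_le_of_le_one_right (abs_nonneg _) h2) ?_
    exact (mul_le_of_le_one_left (abs_nonneg _) h3).trans h1

theorem exists_residue_interval {p : ℕ} [Fact p.Prime] {α β : ℝ} (hα : 0 ≤ α) (hαβ : α ≤ β)
    (hβ : β ≤ 1) :
    ∃ I : Finset (ZMod p), (∀ y : ZMod p, y ∈ I ↔ α ≤ (y.val : ℝ) / p ∧ (y.val : ℝ) / p < β) ∧
      |(I.card : ℝ) / p - (β - α)| ≤ (p : ℝ)⁻¹ ∧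
      ∀ h : ZMod p, ‖(p : ℂ)⁻¹ * ∑ z ∈ I, (ZMod.stdAddChar (h * z) : ℂ)‖
        ≤ if h = 0 then 1 else (p * Real.sin (Real.pi * h.val / p))⁻¹ := by
  have hp0 : (0 : ℝ) < p := by exact_mod_cast (Fact.out : p.Prime).pos
  obtain ⟨A, hA⟩ : ∃ A, A = ⌈p * α⌉₊ := ⟨_, rfl⟩
  obtain ⟨B, hB⟩ : ∃ B, B = ⌈p * β⌉₊ := ⟨_, rfl⟩
  have hAB : A ≤ B := by
    rw [hA, hB]
    exact Nat.ceil_mono (mul_le_mul_of_nonneg_left hαβ hp0.le)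
  have hBp : B ≤ p := by
    rw [hB, Nat.ceil_le]
    exact mul_le_of_le_one_right hp0.le hβ
  have hinj : Set.InjOn (fun m : ℕ => (m : ZMod p)) (Finset.Ico A B) := by
    intro m hm n hn h
    simp only [Finset.coe_Ico, Set.mem_Ico] at hm hn
    have h' := congrArg ZMod.val h
    simp only at h'
    rwa [ZMod.val_natCast_of_lt (by omega), ZMod.val_natCast_of_lt (by omega)] at h'
  have hcard : ((Finset.Ico A B).image fun m : ℕ => (m : ZMod p)).card = B - A := by
    rw [Finset.card_image_of_injOn hinj, Nat.card_Ico]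
  refine ⟨(Finset.Ico A B).image fun m : ℕ => (m : ZMod p), fun y => ?_, ?_, fun h => ?_⟩
  · have h1 : y ∈ ((Finset.Ico A B).image fun m : ℕ => (m : ZMod p)) ↔ A ≤ y.val ∧ y.val < B := by
      rw [Finset.mem_image]
      constructor
      · rintro ⟨m, hm, rfl⟩
        rw [Finset.mem_Ico] at hm
        rwa [ZMod.val_natCast_of_lt (by omega)]
      · intro h
        exact ⟨y.val, Finset.mem_Ico.2 h, ZMod.natCast_zmod_val y⟩
    rw [h1, hA, hB, Nat.ceil_le, Nat.lt_ceil, le_div_iff₀ hp0, div_lt_iff₀ hp0, mul_comm α,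
      mul_comm β]
  · rw [hcard, Nat.cast_sub hAB]
    have h1 : (A : ℝ) < p * α + 1 := by rw [hA]; exact Nat.ceil_lt_add_one (by positivity)
    have h2 : (B : ℝ) < p * β + 1 := by
      rw [hB]; exact Nat.ceil_lt_add_one (mul_nonneg hp0.le (hα.trans hαβ))
    have h3 : p * α ≤ A := by rw [hA]; exact Nat.le_ceil _
    have h4 : p * β ≤ B := by rw [hB]; exact Nat.le_ceil _
    have e : ((B : ℝ) - A) / p - (β - α) = (((B : ℝ) - p * β) - (A - p * α)) * (p : ℝ)⁻¹ := by
      field_simp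
      ring
    rw [e, abs_mul, abs_of_pos (inv_pos.2 hp0)]
    refine mul_le_of_le_one_left (inv_pos.2 hp0).le ?_
    rw [abs_le]
    constructor <;> linarith
  · rw [norm_mul, norm_inv, Complex.norm_natCast]
    split_ifs with h0
    · rw [inv_mul_le_iff₀ hp0, mul_one]
      refine (norm_sum_le_of_le _ fun z _ => (AddChar.norm_apply _ _).le).trans ?_
      rw [Finset.sum_const, nsmul_eq_mul, mul_one, hcard]
      exact_mod_cast (Nat.sub_le _ _).trans hBp
    · rw [Finset.sum_image hinj, mul_inv]
      exact mul_le_mul_of_nonneg_left (norm_sum_Ico_stdAddChar_le h0 hAB) (by positivity)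

theorem sum_erase_zero_eq_sum_Ico {p : ℕ} [Fact p.Prime] (f : ℕ → ℝ) :
    ∑ g ∈ Finset.univ.erase (0 : ZMod p), f g.val = ∑ h ∈ Finset.Ico 1 p, f h := by
  refine Finset.sum_bij (fun g _ => g.val) ?_ ?_ ?_ ?_
  · intro g hg
    rw [Finset.mem_Ico]
    exact ⟨Nat.pos_of_ne_zero ((ZMod.val_ne_zero g).2 (Finset.ne_of_mem_erase hg)), ZMod.val_lt g⟩
  · intro g _ g' _ h
    exact ZMod.val_injective p h
  · intro h hh
    rw [Finset.mem_Ico] at hh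
    refine ⟨(h : ZMod p), ?_, ZMod.val_natCast_of_lt hh.2⟩
    rw [Finset.mem_erase]
    refine ⟨?_, Finset.mem_univ _⟩
    intro h0
    have := congrArg ZMod.val h0
    rw [ZMod.val_natCast_of_lt hh.2, ZMod.val_zero] at this
    omega
  · intro _ _
    rfl

theorem norm_sum_inversive_le {p : ℕ} [Fact p.Prime] (hp3 : 3 ≤ p) {a b : ℤ}
    (ha : (a : ZMod p) ≠ 0) {κ : Type*} [Fintype κ] {offs : κ → ℕ}
    (hinj : Function.Injective offs) (hlt : ∀ i, offs i < p) {ψ : AddChar (ZMod p) ℂ} (hψ : ψ ≠ 1)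
    {h : κ → ZMod p} (hh : h ≠ 0) :
    ‖∑ n : Fin p, ψ (∑ i, h i * ((a * ((n : ℕ) + offs i) + b : ℤ) : ZMod p) ^ (p - 2))‖
      ≤ 2 * (((Finset.univ.filter fun i => h i ≠ 0).card : ℝ) - 1) * √p + 1
        + (Finset.univ.filter fun i => h i ≠ 0).card := by
  classical
  set T := Finset.univ.filter fun i => h i ≠ 0 with hT
  have hpow : ∀ z : ZMod p, z ^ (p - 2) = z⁻¹ := by
    intro z
    rcases eq_or_ne z 0 with rfl | hz
    · rw [zero_pow (by omega), inv_zero]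
    · refine eq_inv_of_mul_eq_one_left ?_
      rw [← pow_succ, show p - 2 + 1 = p - 1 by omega, ZMod.pow_card_sub_one_eq_one hz]
  have hTne : T.Nonempty := by
    by_contra hne
    rw [Finset.not_nonempty_iff_eq_empty, hT, Finset.filter_eq_empty_iff] at hne
    exact hh (funext fun i => not_not.1 (hne (Finset.mem_univ i)))
  have hbij : Function.Bijective fun n : Fin p => ((n : ℕ) : ZMod p) := by
    rw [Fintype.bijective_iff_injective_and_card]
    refine ⟨fun m n hmn => ?_, by rw [Fintype.card_fin, ZMod.card]⟩
    have h' := congrArg ZMod.val hmn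
    simp only at h'
    rw [ZMod.val_natCast_of_lt m.2, ZMod.val_natCast_of_lt n.2] at h'
    exact Fin.ext h'
  have key := norm_sum_addChar_inverses_le hψ T (fun i => h i * (a : ZMod p)⁻¹)
    (fun i => (offs i : ZMod p) + b / a) hTne
    (fun i hi => mul_ne_zero (Finset.mem_filter.1 hi).2 (inv_ne_zero ha)) (by
      intro i _ j _ hij
      have h' := congrArg ZMod.val (add_right_cancel hij)
      rw [ZMod.val_natCast_of_lt (hlt i), ZMod.val_natCast_of_lt (hlt j)] at h'
      exact hinj h')
  refine le_trans (le_of_eq ?_) key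
  congr 1
  rw [← hbij.sum_comp]
  refine Finset.sum_congr rfl fun n _ => ?_
  congr 1
  rw [hT, Finset.sum_filter]
  refine Finset.sum_congr rfl fun i _ => ?_
  split_ifs with h0
  · rw [hpow, mul_assoc, ← mul_inv]
    congr 2
    push_cast
    field_simp
    ring
  · rw [not_not.1 h0, zero_mul]

theorem discrepancy_numerical_bound {p k : ℕ} (hp3 : 3 ≤ p) (hk : 2 ≤ k) {t : ℝ} (ht0 : 0 ≤ t)
    (ht : t ≤ 2 / Real.pi * Real.log p + 2 / 5) :
    (p : ℝ)⁻¹ * (2 * √p * (k * t * (1 + t) ^ (k - 1) - (1 + t) ^ k + 1)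
        + (1 + t) ^ k + k * t * (1 + t) ^ (k - 1) - 1)
      < 2 * (p : ℝ) ^ (-(1 : ℝ) / 2) *
          (((k : ℝ) - 1) * ((2 / Real.pi) * Real.log p + 7 / 5) ^ k + 1) := by
  have hp0 : (0 : ℝ) < p := by exact_mod_cast (by omega : 0 < p)
  have hk' : (2 : ℝ) ≤ k := by exact_mod_cast hk
  obtain ⟨r, hr⟩ : ∃ r, r = √(p : ℝ) := ⟨_, rfl⟩
  have hr0 : 0 < r := by rw [hr]; exact Real.sqrt_pos.2 hp0
  have hr2 : r * r = p := by rw [hr]; exact Real.mul_self_sqrt hp0.le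
  have hrpow : (p : ℝ) ^ (-(1 : ℝ) / 2) = (p : ℝ)⁻¹ * r := by
    rw [show (-(1 : ℝ) / 2) = -(1 / 2) by ring, Real.rpow_neg hp0.le, ← Real.sqrt_eq_rpow, ← hr,
      ← hr2]
    field_simp
  rw [hrpow, ← hr]
  have hlog : Real.log p ≤ 2 * (r - 1) := by
    rw [← hr2, Real.log_mul hr0.ne' hr0.ne']
    have := Real.log_le_sub_one_of_pos hr0
    linarith
  have hlog0 : 0 ≤ Real.log p := Real.log_nonneg (by exact_mod_cast (by omega : 1 ≤ p))
  have hpi : 2 / Real.pi ≤ 2 / 3 := by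
    have := Real.pi_gt_three
    gcongr
  have htr : 3 * t + 1 ≤ 4 * r := by
    have := mul_le_mul_of_nonneg_right hpi hlog0
    linarith
  have hu : (1 + t) ^ k ≤ ((2 / Real.pi) * Real.log p + 7 / 5) ^ k :=
    pow_le_pow_left₀ (by linarith) (by linarith) k
  obtain ⟨m, rfl⟩ : ∃ m, k = m + 1 := ⟨k - 1, by omega⟩
  rw [Nat.add_sub_cancel]
  set U := (1 + t) ^ m with hU
  have hU0 : 0 < U := by positivity
  set L := ((2 / Real.pi) * Real.log p + 7 / 5) ^ (m + 1)
  have hpow : (1 + t) ^ (m + 1) = U * (1 + t) := pow_succ _ _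
  rw [hpow] at hu ⊢
  set c : ℝ := ((m + 1 : ℕ) : ℝ)
  rw [show 2 * ((p : ℝ)⁻¹ * r) * ((c - 1) * L + 1) = (p : ℝ)⁻¹ * (2 * r * ((c - 1) * L + 1)) by
    ring]
  apply mul_lt_mul_of_pos_left _ (inv_pos.2 hp0)
  have h1 : 2 * r * ((c - 1) * (U * (1 + t)) + 1) ≤ 2 * r * ((c - 1) * L + 1) := by
    have : (c - 1) * (U * (1 + t)) ≤ (c - 1) * L := mul_le_mul_of_nonneg_left hu (by linarith)
    exact mul_le_mul_of_nonneg_left (by linarith) (by linarith)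
  refine lt_of_lt_of_le ?_ h1
  have h2 : 1 + t + c * t ≤ 2 * c * r := by
    nlinarith
  have h3 : U * (1 + t + c * t) ≤ U * (2 * c * r) := mul_le_mul_of_nonneg_left h2 hU0.le
  linarith

theorem sum_erase_zero_prod_mul_eq {G κ : Type*} [AddCommGroup G] [Fintype G] [DecidableEq G]
    [Fintype κ] [DecidableEq κ] (ρ : G → ℝ) (hρ : ρ 0 = 1) (r : ℝ) :
    ∑ h ∈ Finset.univ.erase (0 : κ → G), (∏ i, ρ (h i)) *
        (2 * (((Finset.univ.filter fun i => h i ≠ 0).card : ℝ) - 1) * r + 1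
          + (Finset.univ.filter fun i => h i ≠ 0).card)
      = 2 * r * (Fintype.card κ * (∑ g ∈ Finset.univ.erase 0, ρ g)
            * (1 + ∑ g ∈ Finset.univ.erase 0, ρ g) ^ (Fintype.card κ - 1)
          - (1 + ∑ g ∈ Finset.univ.erase 0, ρ g) ^ Fintype.card κ + 1)
        + (1 + ∑ g ∈ Finset.univ.erase 0, ρ g) ^ Fintype.card κ
        + Fintype.card κ * (∑ g ∈ Finset.univ.erase 0, ρ g)
            * (1 + ∑ g ∈ Finset.univ.erase 0, ρ g) ^ (Fintype.card κ - 1) - 1 := by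
  have hsum : ∑ g, ρ g = 1 + ∑ g ∈ Finset.univ.erase 0, ρ g := by
    rw [← Finset.add_sum_erase _ _ (Finset.mem_univ (0 : G)), hρ]
  have hprod : ∑ h : κ → G, ∏ i, ρ (h i) = (1 + ∑ g ∈ Finset.univ.erase 0, ρ g) ^ Fintype.card κ := by
    rw [← hsum, ← Fintype.piFinset_univ, ← Finset.prod_univ_sum, Finset.prod_const,
      Finset.card_univ]
  have hsupp := sum_prod_mul_support_card (κ := κ) ρ
  rw [hsum] at hsupp
  rw [Finset.sum_erase_eq_sub (Finset.mem_univ _)]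
  have hsplit : ∑ h : κ → G, (∏ i, ρ (h i)) *
        (2 * (((Finset.univ.filter fun i => h i ≠ 0).card : ℝ) - 1) * r + 1
          + (Finset.univ.filter fun i => h i ≠ 0).card)
      = (2 * r + 1) * (∑ h : κ → G, (∏ i, ρ (h i)) * ((Finset.univ.filter fun i => h i ≠ 0).card : ℝ))
        + (1 - 2 * r) * ∑ h : κ → G, ∏ i, ρ (h i) := by
    rw [Finset.mul_sum, Finset.mul_sum, ← Finset.sum_add_distrib]
    exact Finset.sum_congr rfl fun h _ => by ring
  rw [hsplit, hsupp, hprod]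
  simp only [Pi.zero_apply, hρ, Finset.prod_const_one, ne_eq, not_true_eq_false,
    Finset.filter_false, Finset.card_empty, Nat.cast_zero]
  ring

theorem stmt_18 (p : ℕ) (hp : p.Prime) (a b : ℤ) (ha : ¬ a ≡ 0 [ZMOD (p : ℤ)])
    (k : ℕ) (hk2 : 2 ≤ k) (hkp : k < p)
    (offs : Fin k → ℕ) (hmono : StrictMono offs)
    (h0 : offs ⟨0, by omega⟩ = 0) (hlt : ∀ i, offs i < p) :
    discrepancy (fun n : Fin p => fun i : Fin k =>
        (((((a * ((n : ℕ) + offs i) + b : ℤ) : ZMod p) ^ (p - 2)).val : ℕ) : ℝ) / p) <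
      2 * (p : ℝ) ^ (-(1 : ℝ) / 2) *
          (((k : ℝ) - 1) * ((2 / Real.pi) * Real.log p + 7 / 5) ^ k + 1) +
        (k : ℝ) * (p : ℝ)⁻¹ := by
  have : Fact p.Prime := ⟨hp⟩
  have hp3 : 3 ≤ p := by omega
  have haz : (a : ZMod p) ≠ 0 := by
    intro h
    exact ha ((ZMod.intCast_eq_intCast_iff a 0 p).1 (by rw [h, Int.cast_zero]))
  have hprim : (ZMod.stdAddChar (N := p)).IsPrimitive := ZMod.isPrimitive_stdAddChar p
  have hψ : (ZMod.stdAddChar (N := p))⁻¹ ≠ 1 := by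
    intro h
    refine hprim one_ne_zero ?_
    rw [AddChar.mulShift_one]
    exact inv_eq_one.1 h
  set ρ : ZMod p → ℝ := fun h => if h = 0 then 1 else (p * Real.sin (Real.pi * h.val / p))⁻¹
    with hρdef
  have hρ0 : ρ 0 = 1 := if_pos rfl
  obtain ⟨t, ht⟩ : ∃ t, t = ∑ g ∈ Finset.univ.erase (0 : ZMod p), ρ g := ⟨_, rfl⟩
  have ht' : t = ∑ h ∈ Finset.Ico 1 p, (p * Real.sin (Real.pi * h / p))⁻¹ := by
    rw [ht, ← sum_erase_zero_eq_sum_Ico fun h : ℕ => ((p : ℝ) * Real.sin (Real.pi * h / p))⁻¹]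
    exact Finset.sum_congr rfl fun g hg => if_neg (Finset.ne_of_mem_erase hg)
  have hp0 : (0 : ℝ) < p := by exact_mod_cast hp.pos
  have ht0 : 0 ≤ t := by
    rw [ht']
    refine Finset.sum_nonneg fun h hh => ?_
    rw [Finset.mem_Ico] at hh
    have hhp : (h : ℝ) ≤ p := by exact_mod_cast hh.2.le
    refine inv_nonneg.2 (mul_nonneg hp0.le (Real.sin_nonneg_of_nonneg_of_le_pi (by positivity) ?_))
    rw [div_le_iff₀ hp0]
    exact mul_le_mul_of_nonneg_left hhp Real.pi_pos.le
  have htle : t ≤ 2 / Real.pi * Real.log p + 2 / 5 := ht' ▸ sum_inv_sin_le hp.two_le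
  refine lt_of_le_of_lt (csSup_le ?_ ?_)
    (add_lt_add_left (discrepancy_numerical_bound hp3 hk2 ht0 htle) _)
  · exact ⟨_, 0, 0, fun _ => ⟨le_rfl, le_rfl, zero_le_one⟩, rfl⟩
  rintro _ ⟨α, β, hαβ, rfl⟩
  choose I hI hIcard hIsum using fun i =>
    exists_residue_interval (p := p) (hαβ i).1 (hαβ i).2.1 (hαβ i).2.2
  have hmain := abs_card_sub_prod_le (X := Fin p) (Fintype.card_fin p) hprim
    (fun n i => ((a * ((n : ℕ) + offs i) + b : ℤ) : ZMod p) ^ (p - 2)) I ρ hIsum _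
    (fun h hh => norm_sum_inversive_le hp3 (b := b) haz hmono.injective hlt hψ hh)
  rw [sum_erase_zero_prod_mul_eq ρ hρ0, ← ht, Fintype.card_fin] at hmain
  have hvol := abs_prod_sub_prod_le_sum Finset.univ (fun i => ((I i).card : ℝ) / p)
    (fun i => β i - α i) (fun i _ => by
      rw [abs_of_nonneg (by positivity), div_le_one hp0]
      exact_mod_cast (Finset.card_le_univ _).trans_eq (ZMod.card p))
    (fun i _ => by
      rw [abs_of_nonneg (by linarith [(hαβ i).2.1])]
      linarith [(hαβ i).1, (hαβ i).2.2])
  have hvol' : ∑ i, |((I i).card : ℝ) / p - (β i - α i)| ≤ k * (p : ℝ)⁻¹ :=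
    (Finset.sum_le_sum fun i _ => hIcard i).trans_eq (by simp)
  refine (abs_sub_le _ (∏ i, ((I i).card : ℝ) / p) _).trans
    (add_le_add (le_trans (le_of_eq ?_) hmain) (hvol.trans hvol'))
  congr 4
  refine congrArg Finset.card (Finset.ext fun n => ?_)
  simp only [Finset.mem_filter, Finset.mem_univ, true_and, hI]
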